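/- arXiv:1704.04606 — 4 statements merged into one kernel-verified Lean document; each statement's English description precedes it below -/
import Mathlib

section
/- Let r ≥ 1 be an integer, z ∈ ℝ_{>0}, v ∈ ℝ_{>0}^r. Then there exists a function f analytic on ℂ ∖ {1, 2, …, r} such that f(s) = ∑_{m ∈ (ℤ_{≥0})^r} (z + m_1 v_1 + … + m_r v_r)^{−s} for all s with Re(s) > r. In particular, Barnes' multiple zeta series has an analytic continuation that is analytic at s = 0. -/
open Complex Filter Topology Asymptotics Set MeasureTheory

lemma exists_differentiableOn_inv_Gamma_div (r n : ℕ) :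
    ∃ g : ℂ → ℂ,
      DifferentiableOn ℂ g {s : ℂ | ∀ k : ℕ, 1 ≤ k → k ≤ r → s ≠ (k : ℂ)} ∧
      ∀ s : ℂ, s + ((n : ℂ) - r) ≠ 0 → g s = (Gamma s)⁻¹ * (1 / (s + ((n : ℂ) - r))) := by
  rcases lt_or_ge n r with hn | hn
  · refine ⟨fun s ↦ (Gamma s)⁻¹ * (1 / (s + ((n : ℂ) - r))), ?_, fun s _ ↦ rfl⟩
    refine differentiable_one_div_Gamma.differentiableOn.mul
      ((differentiableOn_const _).div (by fun_prop) fun s hs h ↦ ?_)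
    refine hs (r - n) (by omega) (by omega) ?_
    rw [Nat.cast_sub hn.le]
    linear_combination h
  · obtain ⟨k, rfl⟩ := Nat.exists_eq_add_of_le hn
    refine ⟨dslope (fun s : ℂ ↦ (Gamma s)⁻¹) (-k), ?_, fun s hs ↦ ?_⟩
    · exact (((differentiableOn_dslope univ_mem).2
        differentiable_one_div_Gamma.differentiableOn)).mono (subset_univ _)
    · have hs' : s ≠ -k := by
        rintro rfl
        exact hs (by push_cast; ring)
      rw [dslope_of_ne _ hs', slope_def_field, Complex.Gamma_neg_nat_eq_zero]
      have : s + (((r + k : ℕ) : ℂ) - r) = s - -k := by push_cast; ring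
      rw [this]
      simp [div_eq_mul_inv]

/-- If `F` decays exponentially at infinity and has an asymptotic expansion `∑ cₙ tⁿ⁻ʳ` at `0`,
then its Mellin transform divided by `Γ` continues analytically to `ℂ ∖ {1, …, r}`. -/
lemma exists_differentiableOn_eq_inv_Gamma_mul_mellin (r : ℕ) {F : ℝ → ℂ} {a : ℝ} (ha : 0 < a)
    (c : ℕ → ℂ) (hF : LocallyIntegrableOn F (Ioi 0))
    (hF_top : F =O[atTop] fun t ↦ Real.exp (-a * t))
    (hF_zero : ∀ N : ℕ, (fun t : ℝ ↦ F t - ∑ n ∈ Finset.range N, c n * (t : ℂ) ^ ((n : ℂ) - r))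
      =O[𝓝[>] 0] fun t ↦ t ^ (-((r : ℝ) - N))) :
    ∃ f : ℂ → ℂ,
      DifferentiableOn ℂ f {s : ℂ | ∀ k : ℕ, 1 ≤ k → k ≤ r → s ≠ (k : ℂ)} ∧
      ∀ s : ℂ, (r : ℝ) < s.re → f s = (Gamma s)⁻¹ * mellin F s := by
  choose g hg_diff hg_eq using exists_differentiableOn_inv_Gamma_div r
  set U := {s : ℂ | ∀ k : ℕ, 1 ≤ k → k ≤ r → s ≠ (k : ℂ)}
  let χ : ℕ → ℝ → ℂ := fun n ↦ indicator (Ioc 0 1) (fun t : ℝ ↦ (t : ℂ) ^ ((n : ℂ) - r))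
  let H : ℕ → ℝ → ℂ := fun N t ↦ F t - ∑ n ∈ Finset.range N, c n * χ n t
  let f : ℕ → ℂ → ℂ := fun N s ↦
    (Gamma s)⁻¹ * mellin (H N) s + ∑ n ∈ Finset.range N, c n * g n s
  have hχ_int (n : ℕ) : LocallyIntegrableOn (χ n) (Ioi 0) := by
    have h1 : ContinuousOn (fun t : ℝ ↦ (t : ℂ) ^ ((n : ℂ) - r)) (Ioi 0) := fun t ht ↦
      (continuousAt_ofReal_cpow_const _ _ (Or.inr (ne_of_gt ht))).continuousWithinAt
    intro t ht
    obtain ⟨u, hu, hu'⟩ := (h1.locallyIntegrableOn (μ := volume) measurableSet_Ioi) t ht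
    exact ⟨u, hu, hu'.indicator measurableSet_Ioc⟩
  have hH_int (N : ℕ) : LocallyIntegrableOn (H N) (Ioi 0) := by
    refine hF.sub ?_
    induction N with
    | zero => exact fun t ht ↦ ⟨Ioi 0, self_mem_nhdsWithin, by simp⟩
    | succ N ih =>
      simp only [Finset.sum_range_succ]
      exact ih.add fun t ht ↦ ((hχ_int N) t ht).imp fun u hu ↦ ⟨hu.1, hu.2.const_mul _⟩
  have hH_top (N : ℕ) : H N =O[atTop] fun t ↦ Real.exp (-a * t) := by
    refine hF_top.congr' ?_ EventuallyEq.rfl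
    filter_upwards [eventually_gt_atTop 1] with t ht
    simp [H, χ, ht]
  have hH_zero (N : ℕ) : H N =O[𝓝[>] 0] fun t ↦ t ^ (-((r : ℝ) - N)) := by
    refine (hF_zero N).congr' ?_ EventuallyEq.rfl
    filter_upwards [Ioc_mem_nhdsGT one_pos] with t ht
    simp [H, χ, ht.1, ht.2]
  have hf_diff (N : ℕ) : ∀ s ∈ U, (r : ℝ) - N < s.re → DifferentiableWithinAt ℂ (f N) U s := by
    intro s hs hsN
    refine ((differentiable_one_div_Gamma s).mul
      (mellin_differentiableAt_of_isBigO_rpow_exp ha (hH_int N) (hH_top N)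
        (hH_zero N) hsN)).differentiableWithinAt.add ?_
    exact DifferentiableWithinAt.fun_sum fun n _ ↦ (hg_diff n s hs).const_mul _
  have hf_succ (N : ℕ) (s : ℂ) (hs : (r : ℝ) - N < s.re) : f (N + 1) s = f N s := by
    have hm := hasMellin_cpow_Ioc ((N : ℂ) - r) (s := s) (by simp; linarith)
    have hmc : HasMellin (fun t ↦ c N • χ N t) s (c N • (1 / (s + ((N : ℂ) - r)))) :=
      hm.2 ▸ hasMellin_const_smul hm.1 (c N)
    have hHc := mellinConvergent_of_isBigO_rpow_exp ha (hH_int N) (hH_top N) (hH_zero N) hs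
    have hsub := (hasMellin_sub hHc hmc.1).2
    have hH_succ : H (N + 1) = fun t ↦ H N t - c N • χ N t := by
      ext t
      simp only [H, Finset.sum_range_succ, smul_eq_mul]
      ring
    have hne : s + ((N : ℂ) - r) ≠ 0 := fun h ↦ by
      have := congrArg re h
      simp at this
      linarith
    simp only [f, Finset.sum_range_succ]
    rw [hH_succ, hsub, hmc.2, hg_eq N s hne, smul_eq_mul]
    ring
  have hf_eq (M N : ℕ) (s : ℂ) (hM : (r : ℝ) - M < s.re) (hN : (r : ℝ) - N < s.re) :
      f M s = f N s := by
    have key (M N : ℕ) (hMN : M ≤ N) (hM : (r : ℝ) - M < s.re) : f N s = f M s := by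
      induction N, hMN using Nat.le_induction with
      | base => rfl
      | succ N hMN ih =>
        rw [hf_succ N s, ih]
        have : (M : ℝ) ≤ N := mod_cast hMN
        linarith
    rcases le_total M N with h | h
    · exact (key M N h hM).symm
    · exact key N M h hN
  choose N hN using fun s : ℂ ↦ exists_nat_gt ((r : ℝ) - s.re)
  refine ⟨fun s ↦ f (N s) s, fun s hs ↦ ?_, fun s hs ↦ ?_⟩
  · have hs' : (r : ℝ) - N s < s.re := by linarith [hN s]
    refine (hf_diff (N s) s hs hs').congr_of_eventuallyEq ?_ rfl
    filter_upwards [mem_nhdsWithin_of_mem_nhds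
      ((isOpen_lt continuous_const continuous_re).mem_nhds hs')] with w hw
    exact hf_eq _ _ w (by linarith [hN w]) hw
  · refine (hf_eq (N s) 0 s (by linarith [hN s]) (by simpa using hs)).trans ?_
    simp [f, H]

lemma hasSum_prod_fin_pi {r : ℕ} {ι : Type*} {f : Fin r → ι → ℝ} {a : Fin r → ℝ}
    (hf : ∀ i n, 0 ≤ f i n) (h : ∀ i, HasSum (f i) (a i)) :
    HasSum (fun m : Fin r → ι ↦ ∏ i, f i (m i)) (∏ i, a i) := by
  induction r with
  | zero => simp
  | succ r ih =>
    rw [← (Fin.consEquiv fun _ ↦ ι).hasSum_iff, Fin.prod_univ_succ]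
    have h' := ih (f := fun i ↦ f i.succ) (fun i ↦ hf _) (fun i ↦ h _)
    have hs := (h 0).summable.mul_of_nonneg h'.summable (hf 0)
      fun m ↦ Finset.prod_nonneg fun i _ ↦ hf _ _
    convert! (h 0).mul h' hs using 2 with p
    simp [Fin.prod_univ_succ, Fin.consEquiv]

lemma summable_inv_add_sum_rpow {r : ℕ} {z : ℝ} (hz : 0 < z) {v : Fin r → ℝ} (hv : ∀ i, 0 < v i)
    {σ : ℝ} (hσ : (r : ℝ) < σ) :
    Summable fun m : Fin r → ℕ ↦ ((z + ∑ i, (m i : ℝ) * v i) ^ σ)⁻¹ := by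
  have hσ0 : 0 < σ := r.cast_nonneg.trans_lt hσ
  rcases Nat.eq_zero_or_pos r with rfl | hr
  · exact Summable.of_finite
  have hr' : (0 : ℝ) < r := mod_cast hr
  have hc (i : Fin r) : 0 < min z (v i) := lt_min hz (hv i)
  have hsum (i : Fin r) : Summable fun n : ℕ ↦ ((min z (v i) * (n + 1)) ^ (σ / r))⁻¹ := by
    have h1 : Summable fun n : ℕ ↦ ((((n + 1 : ℕ) : ℝ)) ^ (σ / r))⁻¹ :=
      (summable_nat_add_iff 1).2
        (Real.summable_nat_rpow_inv.2 ((one_lt_div hr').2 hσ))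
    refine (h1.mul_left ((min z (v i)) ^ (σ / r))⁻¹).congr fun n ↦ ?_
    rw [Real.mul_rpow (hc i).le (by positivity), mul_inv]
    push_cast
    rfl
  have hprod := (hasSum_prod_fin_pi
    (fun i n ↦ inv_nonneg.2 (Real.rpow_nonneg (mul_nonneg (hc i).le (by positivity)) _))
    (fun i ↦ (hsum i).hasSum)).summable
  refine hprod.of_nonneg_of_le (fun m ↦ ?_) fun m ↦ ?_
  · have : 0 ≤ ∑ i, (m i : ℝ) * v i :=
      Finset.sum_nonneg fun i _ ↦ mul_nonneg (by positivity) (hv i).le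
    positivity
  · have hpos : 0 < z + ∑ i, (m i : ℝ) * v i := add_pos_of_pos_of_nonneg hz <|
      Finset.sum_nonneg fun i _ ↦ mul_nonneg (by positivity) (hv i).le
    have hpow : (z + ∑ i, (m i : ℝ) * v i) ^ σ
        = ∏ _i : Fin r, (z + ∑ i, (m i : ℝ) * v i) ^ (σ / r) := by
      rw [Finset.prod_const, Finset.card_univ, Fintype.card_fin, ← Real.rpow_mul_natCast hpos.le,
        div_mul_cancel₀ _ hr'.ne']
    rw [hpow, ← Finset.prod_inv_distrib]
    refine Finset.prod_le_prod (fun i _ ↦ by positivity) fun i _ ↦ ?_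
    have hci : 0 < min z (v i) * ((m i : ℝ) + 1) := mul_pos (hc i) (by positivity)
    refine inv_anti₀ (Real.rpow_pos_of_pos hci _)
      (Real.rpow_le_rpow hci.le ?_ (by positivity))
    have h1 : (m i : ℝ) * v i ≤ ∑ i, (m i : ℝ) * v i :=
      Finset.single_le_sum (f := fun i ↦ (m i : ℝ) * v i)
        (fun i _ ↦ mul_nonneg (by positivity) (hv i).le) (Finset.mem_univ i)
    have h2 : min z (v i) * m i ≤ v i * m i := by gcongr; exact min_le_right _ _
    linarith [min_le_left z (v i)]

/-- The exponential series attached to Barnes' multiple zeta series, in closed form: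
its Mellin transform is `Γ(s) ζ(s, v, z)`. -/
noncomputable def barnesKernel {r : ℕ} (z : ℝ) (v : Fin r → ℝ) (t : ℝ) : ℝ :=
  Real.exp (-z * t) * ∏ i, (1 - Real.exp (-v i * t))⁻¹

lemma hasSum_barnesKernel {r : ℕ} (z : ℝ) {v : Fin r → ℝ} (hv : ∀ i, 0 < v i)
    {t : ℝ} (ht : 0 < t) :
    HasSum (fun m : Fin r → ℕ ↦ Real.exp (-(z + ∑ i, (m i : ℝ) * v i) * t))
      (barnesKernel z v t) := by
  have h := (hasSum_prod_fin_pi (f := fun i n ↦ Real.exp (-v i * t) ^ n)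
    (fun i n ↦ by positivity) fun i ↦ hasSum_geometric_of_lt_one (Real.exp_pos _).le
      (Real.exp_lt_one_iff.2 (by nlinarith [mul_pos (hv i) ht]))).mul_left (Real.exp (-z * t))
  rw [barnesKernel]
  convert! h using 2 with m
  simp only [← Real.exp_nat_mul, ← Real.exp_sum, ← Real.exp_add]
  congr 1
  rw [neg_mul, add_mul, neg_add, ← neg_mul, Finset.sum_mul, ← Finset.sum_neg_distrib]
  congr 1
  exact Finset.sum_congr rfl fun i _ ↦ by ring

lemma one_sub_exp_ne_zero {a t : ℝ} (ha : 0 < a) (ht : 0 < t) : 1 - Real.exp (-a * t) ≠ 0 :=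
  (sub_pos.2 (Real.exp_lt_one_iff.2 (by nlinarith [mul_pos ha ht]))).ne'

lemma continuousOn_barnesKernel {r : ℕ} (z : ℝ) {v : Fin r → ℝ} (hv : ∀ i, 0 < v i) :
    ContinuousOn (barnesKernel z v) (Ioi 0) := by
  refine ContinuousOn.mul (by fun_prop) (continuousOn_finsetProd _ fun i _ ↦ ?_)
  exact ContinuousOn.inv₀ (by fun_prop) fun t ht ↦ one_sub_exp_ne_zero (hv i) ht

lemma barnesKernel_isBigO_atTop {r : ℕ} (z : ℝ) {v : Fin r → ℝ} (hv : ∀ i, 0 < v i) :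
    barnesKernel z v =O[atTop] fun t ↦ Real.exp (-z * t) := by
  have h : Tendsto (fun t : ℝ ↦ ∏ i, (1 - Real.exp (-v i * t))⁻¹) atTop
      (𝓝 (∏ _i : Fin r, (1 - 0)⁻¹)) := by
    refine tendsto_finsetProd _ fun i _ ↦ Tendsto.inv₀ (tendsto_const_nhds.sub ?_) (by simp)
    exact Real.tendsto_exp_atBot.comp (tendsto_id.const_mul_atTop_of_neg (by simpa using hv i))
  simpa only [mul_one] using!
    (isBigO_refl (fun t ↦ Real.exp (-z * t)) atTop).mul (h.isBigO_one ℝ)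

/-- Up to a pole of order `r`, the kernel is analytic at the origin. -/
lemma exists_analyticAt_barnesKernel_eq {r : ℕ} (z : ℝ) {v : Fin r → ℝ} (hv : ∀ i, 0 < v i) :
    ∃ G : ℝ → ℝ, AnalyticAt ℝ G 0 ∧ ∀ t : ℝ, 0 < t → barnesKernel z v t = (t ^ r)⁻¹ * G t := by
  let h : Fin r → ℝ → ℝ := fun i t ↦ 1 - Real.exp (-v i * t)
  have h_an (i : Fin r) : AnalyticAt ℝ (h i) 0 := by fun_prop
  have h_an' (i : Fin r) : AnalyticAt ℝ (dslope (h i) 0) 0 := by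
    obtain ⟨p, hp⟩ := h_an i
    exact ⟨_, hp.has_fpower_series_dslope_fslope⟩
  have h_deriv (i : Fin r) : dslope (h i) 0 0 = v i := by
    rw [dslope_same]
    have : HasDerivAt (h i) (-(Real.exp (-v i * 0) * (-v i * 1))) 0 :=
      (((hasDerivAt_id (0 : ℝ)).const_mul (-v i)).exp).const_sub 1
    simpa using this.deriv
  refine ⟨fun t ↦ Real.exp (-z * t) * ∏ i, (dslope (h i) 0 t)⁻¹, ?_, fun t ht ↦ ?_⟩
  · refine AnalyticAt.mul (by fun_prop) (Finset.analyticAt_fun_prod _ fun i _ ↦ ?_)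
    exact (h_an' i).fun_inv (by rw [h_deriv]; exact (hv i).ne')
  · have : ∀ i, dslope (h i) 0 t = h i t / t := fun i ↦ by
      rw [dslope_of_ne _ ht.ne', slope_def_field]
      simp [h]
    have hprod : ∏ i, (dslope (h i) 0 t)⁻¹ = t ^ r * ∏ i, (h i t)⁻¹ := by
      simp [this, div_eq_mul_inv, Finset.prod_mul_distrib]
    simp only [hprod, barnesKernel, h]
    field_simp

lemma barnesKernel_asymptotic_zero {r : ℕ} (z : ℝ) {v : Fin r → ℝ} (hv : ∀ i, 0 < v i) :
    ∃ c : ℕ → ℂ, ∀ N : ℕ,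
      (fun t : ℝ ↦ (barnesKernel z v t : ℂ)
        - ∑ n ∈ Finset.range N, c n * (t : ℂ) ^ ((n : ℂ) - r))
      =O[𝓝[>] 0] fun t ↦ t ^ (-((r : ℝ) - N)) := by
  obtain ⟨G, ⟨p, hp⟩, hG⟩ := exists_analyticAt_barnesKernel_eq z hv
  refine ⟨fun n ↦ p.coeff n, fun N ↦ ?_⟩
  have h1 := (hp.isBigO_sub_partialSum_pow N).mono (nhdsWithin_le_nhds (s := Ioi 0))
  have h2 := (isBigO_refl (fun t : ℝ ↦ (t ^ r)⁻¹) (𝓝[>] 0)).mul h1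
  have h3 := (isBigO_ofReal_left).2 h2
  refine h3.congr' ?_ ?_
  · filter_upwards [self_mem_nhdsWithin] with t (ht : 0 < t)
    have ht' : (t : ℂ) ≠ 0 := ofReal_ne_zero.2 ht.ne'
    simp only [hG t ht, FormalMultilinearSeries.partialSum, zero_add]
    push_cast
    rw [mul_sub, Finset.mul_sum]
    congr 1
    refine Finset.sum_congr rfl fun n _ ↦ ?_
    rw [cpow_sub _ _ ht', cpow_natCast, cpow_natCast,
      FormalMultilinearSeries.apply_eq_pow_smul_coeff]
    push_cast [smul_eq_mul]
    field_simp
  · filter_upwards [self_mem_nhdsWithin] with t (ht : 0 < t)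
    rw [neg_sub, Real.rpow_sub ht, Real.rpow_natCast, Real.rpow_natCast, Real.norm_of_nonneg ht.le,
      div_eq_mul_inv, mul_comm]

/-- Barnes' multiple zeta series has an analytic continuation to
`ℂ ∖ {1, 2, …, r}`; in particular it is analytic at `s = 0`. -/
theorem barnes_zeta_analytic_continuation (r : ℕ) (hr : 1 ≤ r) (z : ℝ) (hz : 0 < z)
    (v : Fin r → ℝ) (hv : ∀ i, 0 < v i) :
    ∃ f : ℂ → ℂ,
      AnalyticOnNhd ℂ f {s : ℂ | ∀ k : ℕ, 1 ≤ k → k ≤ r → s ≠ (k : ℂ)} ∧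
      ∀ s : ℂ, (r : ℝ) < s.re →
        f s = ∑' m : Fin r → ℕ,
          Complex.exp (-s * (Real.log (z + ∑ i, (m i : ℝ) * v i) : ℂ)) := by
  obtain ⟨c, hc⟩ := barnesKernel_asymptotic_zero z hv
  obtain ⟨f, hf, hfs⟩ := exists_differentiableOn_eq_inv_Gamma_mul_mellin r hz c
    (F := fun t ↦ (barnesKernel z v t : ℂ))
    ((continuous_ofReal.comp_continuousOn
      (continuousOn_barnesKernel z hv)).locallyIntegrableOn measurableSet_Ioi)
    (isBigO_ofReal_left.2 (barnesKernel_isBigO_atTop z hv)) hc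
  refine ⟨f, hf.analyticOnNhd ?_, fun s hs ↦ ?_⟩
  · have : {s : ℂ | ∀ k : ℕ, 1 ≤ k → k ≤ r → s ≠ (k : ℂ)}
        = ((Finset.Icc 1 r).image (Nat.cast : ℕ → ℂ) : Set ℂ)ᶜ := by
      ext s
      simp only [mem_ofPred_eq, Finset.coe_image, Finset.coe_Icc, mem_compl_iff, mem_image, mem_Icc]
      grind
    rw [this]
    exact (Finset.finite_toSet _).isClosed.isOpen_compl
  · have hs0 : 0 < s.re := r.cast_nonneg.trans_lt hs
    have hpos (m : Fin r → ℕ) : 0 < z + ∑ i, (m i : ℝ) * v i := add_pos_of_pos_of_nonneg hz <|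
      Finset.sum_nonneg fun i _ ↦ mul_nonneg (by positivity) (hv i).le
    have h := hasSum_mellin (a := fun _ : Fin r → ℕ ↦ 1) (F := fun t ↦ (barnesKernel z v t : ℂ))
      (fun m ↦ Or.inr (hpos m)) hs0
      (fun t ht ↦ by simpa using! Complex.hasSum_ofReal.2 (hasSum_barnesKernel z hv ht))
      (by simpa using summable_inv_add_sum_rpow hz hv hs)
    rw [hfs s hs, ← (h.mul_left (Gamma s)⁻¹).tsum_eq]
    refine tsum_congr fun m ↦ ?_
    rw [mul_one, ← mul_div_assoc, inv_mul_cancel₀ (Gamma_ne_zero_of_re_pos hs0), one_div,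
      cpow_def_of_ne_zero (ofReal_ne_zero.2 (hpos m).ne'), ← Complex.exp_neg, ofReal_log (hpos m).le]
    congr 1
    ring
end

section
/- Let l, r ≥ 1 be integers, A = (a_{ij}) an l×r matrix of positive real numbers, x ∈ ℝ_{>0}^r, and suppose each χ_j ∈ ℂ is a root of unity with χ_j ≠ 1. Then there exists an entire function f : ℂ → ℂ such that f(s) = ζ(s, A, x, χ) for all s with Re(s) > r/l. -/
namespace Shintani

open Filter Topology MeasureTheory Set

section ParametricIntegral

variable {X : Type*} [TopologicalSpace X]

lemma exists_eventually_norm_le {F : X → ℝ → ℂ} {p₀ : X}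
    (hF : ∀ t ∈ Icc (0 : ℝ) 1, ContinuousAt (Function.uncurry F) (p₀, t)) :
    ∃ M : ℝ, ∀ᶠ p in 𝓝 p₀, ∀ t ∈ Icc (0 : ℝ) 1, ‖F p t‖ ≤ M := by
  have hc : ContinuousOn (F p₀) (Icc 0 1) := fun t ht ↦
    ((hF t ht).comp (f := fun t : ℝ ↦ (p₀, t)) (by fun_prop)).continuousWithinAt
  obtain ⟨M, hM⟩ := isCompact_Icc.exists_bound_of_continuousOn hc
  refine ⟨M + 1, isCompact_Icc.eventually_forall_of_forall_eventually fun t ht ↦ ?_⟩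
  have h := (hF t ht).norm.eventually_lt_const (u := M + 1) (by
    have := hM t ht
    simpa using lt_of_le_of_lt this (lt_add_one M))
  exact h.mono fun z hz ↦ hz.le

lemma continuousOn_of_continuousAt_uncurry {F : X → ℝ → ℂ} {p : X}
    (hF : ∀ t ∈ Icc (0 : ℝ) 1, ContinuousAt (Function.uncurry F) (p, t)) :
    ContinuousOn (F p) (Icc 0 1) := fun t ht ↦
  ((hF t ht).comp (f := fun t : ℝ ↦ (p, t)) (by fun_prop)).continuousWithinAt

lemma aestronglyMeasurable_of_continuousAt_uncurry {F : X → ℝ → ℂ} {p : X}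
    (hF : ∀ t ∈ Icc (0 : ℝ) 1, ContinuousAt (Function.uncurry F) (p, t)) :
    AEStronglyMeasurable (F p) (volume.restrict (uIoc (0 : ℝ) 1)) := by
  rw [uIoc_of_le zero_le_one]
  exact ((continuousOn_of_continuousAt_uncurry hF).mono Ioc_subset_Icc_self).aestronglyMeasurable
    measurableSet_Ioc

lemma continuousAt_intervalIntegral [FirstCountableTopology X] {F : X → ℝ → ℂ} {p₀ : X}
    (hF : ∀ᶠ p in 𝓝 p₀, ∀ t ∈ Icc (0 : ℝ) 1, ContinuousAt (Function.uncurry F) (p, t)) :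
    ContinuousAt (fun p ↦ ∫ t in (0 : ℝ)..1, F p t) p₀ := by
  obtain ⟨M, hM⟩ := exists_eventually_norm_le hF.self_of_nhds
  have hsub : ∀ t ∈ uIoc (0 : ℝ) 1, t ∈ Icc (0 : ℝ) 1 := fun t ht ↦ by
    rw [uIoc_of_le zero_le_one] at ht
    exact Ioc_subset_Icc_self ht
  refine intervalIntegral.continuousAt_of_dominated_interval (bound := fun _ ↦ M)
    (hF.mono fun p hp ↦ aestronglyMeasurable_of_continuousAt_uncurry hp)
    (hM.mono fun p hp ↦ ae_of_all _ fun t ht ↦ hp t (hsub t ht)) (by simp)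
    (ae_of_all _ fun t ht ↦ ?_)
  exact (hF.self_of_nhds t (hsub t ht)).comp (f := fun p : X ↦ (p, t)) (by fun_prop)

lemma differentiableAt_intervalIntegral {F : ℂ → ℝ → ℂ} {s₀ : ℂ}
    (hF : ∀ᶠ s in 𝓝 s₀, ∀ t ∈ Icc (0 : ℝ) 1,
      ContinuousAt (Function.uncurry F) (s, t) ∧ DifferentiableAt ℂ (fun z ↦ F z t) s) :
    DifferentiableAt ℂ (fun s ↦ ∫ t in (0 : ℝ)..1, F s t) s₀ := by
  obtain ⟨M, hM⟩ := exists_eventually_norm_le fun t ht ↦ (hF.self_of_nhds t ht).1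
  obtain ⟨δ, hδ, hball⟩ := Metric.eventually_nhds_iff_ball.1 (hF.and hM)
  have hsub : ∀ t ∈ uIoc (0 : ℝ) 1, t ∈ Icc (0 : ℝ) 1 := fun t ht ↦ by
    rw [uIoc_of_le zero_le_one] at ht
    exact Ioc_subset_Icc_self ht
  have hs₀ := hF.self_of_nhds
  have hmeas : AEStronglyMeasurable (fun t ↦ deriv (fun z ↦ F z t) s₀)
      (volume.restrict (uIoc (0 : ℝ) 1)) := by
    let e : ℕ → ℂ := fun n ↦ ((δ / 2 * (1 / ((n : ℝ) + 1)) : ℝ) : ℂ)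
    have he : Tendsto e atTop (𝓝[≠] 0) := by
      refine tendsto_nhdsWithin_iff.2 ⟨?_, Eventually.of_forall fun n ↦ ?_⟩
      · have := (tendsto_one_div_add_atTop_nhds_zero_nat (𝕜 := ℝ)).const_mul (δ / 2)
        rw [mul_zero] at this
        have h := (Complex.continuous_ofReal.tendsto 0).comp this
        rwa [Complex.ofReal_zero] at h
      · have : (0 : ℝ) < δ / 2 * (1 / ((n : ℝ) + 1)) := by positivity
        simpa [e] using (Complex.ofReal_ne_zero.2 this.ne')
    have hmem : ∀ n, s₀ + e n ∈ Metric.ball s₀ δ := fun n ↦ by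
      have h0 : (0 : ℝ) < δ / 2 * (1 / ((n : ℝ) + 1)) := by positivity
      have h1 : 1 / ((n : ℝ) + 1) ≤ 1 := by
        rw [div_le_one (by positivity)]; linarith [(Nat.cast_nonneg n : (0 : ℝ) ≤ n)]
      rw [mem_ball_iff_norm, add_sub_cancel_left, Complex.norm_real, Real.norm_of_nonneg h0.le]
      nlinarith
    refine aestronglyMeasurable_of_tendsto_ae atTop
      (f := fun n t ↦ (e n)⁻¹ • (F (s₀ + e n) t - F s₀ t)) (fun n ↦ ?_) ?_
    · change AEStronglyMeasurable ((e n)⁻¹ • (F (s₀ + e n) - F s₀)) _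
      refine AEStronglyMeasurable.const_smul (.sub ?_ ?_) _
      · exact aestronglyMeasurable_of_continuousAt_uncurry
          fun t ht ↦ ((hball _ (hmem n)).1 t ht).1
      · exact aestronglyMeasurable_of_continuousAt_uncurry fun t ht ↦ (hs₀ t ht).1
    · refine (ae_restrict_iff' measurableSet_uIoc).2 (ae_of_all _ fun t ht ↦ ?_)
      exact (hs₀ t (hsub t ht)).2.hasDerivAt.tendsto_slope_zero.comp he
  have hderiv : ∀ t ∈ Icc (0 : ℝ) 1, ∀ s ∈ Metric.ball s₀ (δ / 2),
      ‖deriv (fun z ↦ F z t) s‖ ≤ M / (δ / 4) := fun t ht s hs ↦ by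
    have hcl : Metric.closedBall s (δ / 4) ⊆ Metric.ball s₀ δ := fun z hz ↦ by
      rw [Metric.mem_closedBall] at hz
      rw [Metric.mem_ball] at hs ⊢
      linarith [dist_triangle z s s₀]
    refine Complex.norm_deriv_le_of_forall_mem_sphere_norm_le (by positivity) ?_
      fun z hz ↦ (hball z (hcl (Metric.sphere_subset_closedBall hz))).2 t ht
    refine DifferentiableOn.diffContOnCl fun z hz ↦ ?_
    rw [closure_ball _ (by positivity)] at hz
    exact ((hball z (hcl hz)).1 t ht).2.differentiableWithinAt
  refine (intervalIntegral.hasDerivAt_integral_of_dominated_loc_of_deriv_le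
    (F' := fun s t ↦ deriv (fun z ↦ F z t) s) (bound := fun _ ↦ M / (δ / 4))
    (Metric.ball_mem_nhds s₀ (half_pos hδ))
    (hF.mono fun s hs ↦ aestronglyMeasurable_of_continuousAt_uncurry fun t ht ↦ (hs t ht).1)
    ?_ hmeas (ae_of_all _ fun t ht ↦ hderiv t (hsub t ht)) (by simp)
    (ae_of_all _ fun t ht s hs ↦ ?_)).2.differentiableAt
  · refine ContinuousOn.intervalIntegrable ?_
    rw [uIcc_of_le zero_le_one]
    exact continuousOn_of_continuousAt_uncurry fun t ht ↦ (hs₀ t ht).1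
  · exact ((hball s (Metric.ball_subset_ball (by linarith) hs)).1 t (hsub t ht)).2.hasDerivAt

end ParametricIntegral

lemma summable_prod_pi {g : ℕ → ℝ} (hg : Summable g) (hg0 : ∀ n, 0 ≤ g n) (r : ℕ) :
    Summable fun m : Fin r → ℕ ↦ ∏ j, g (m j) := by
  induction r with
  | zero => exact Summable.of_finite
  | succ r ih =>
    rw [← (Fin.consEquiv fun _ : Fin (r + 1) ↦ ℕ).summable_iff]
    have := hg.mul_of_nonneg ih hg0 fun m ↦ Finset.prod_nonneg fun j _ ↦ hg0 _
    refine this.congr fun m ↦ ?_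
    simp [Fin.consEquiv, Fin.prod_univ_succ]

lemma summable_one_add_sum_rpow (r : ℕ) {p : ℝ} (hp : r < p) :
    Summable fun m : Fin r → ℕ ↦ (1 + ∑ j, (m j : ℝ)) ^ (-p) := by
  rcases Nat.eq_zero_or_pos r with rfl | hr
  · exact Summable.of_finite
  have hr' : (0 : ℝ) < r := by exact_mod_cast hr
  have h1 : 1 < p / r := by rwa [lt_div_iff₀ hr', one_mul]
  have hs : Summable fun n : ℕ ↦ (1 + (n : ℝ)) ^ (-(p / r)) := by
    have := (summable_nat_add_iff 1).2 (Real.summable_nat_rpow.2 (neg_lt_neg h1))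
    refine this.congr fun n ↦ ?_
    push_cast
    rw [add_comm]
  refine Summable.of_nonneg_of_le (fun m ↦ by positivity) (fun m ↦ ?_)
    (summable_prod_pi hs (fun n ↦ by positivity) r)
  have hM : 0 < 1 + ∑ j, (m j : ℝ) := by positivity
  calc (1 + ∑ j, (m j : ℝ)) ^ (-p) = ∏ j : Fin r, (1 + ∑ j, (m j : ℝ)) ^ (-(p / r)) := by
        rw [Finset.prod_const, Finset.card_univ, Fintype.card_fin, ← Real.rpow_mul_natCast hM.le]
        congr 1
        field_simp
    _ ≤ ∏ j, (1 + (m j : ℝ)) ^ (-(p / r)) := by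
        refine Finset.prod_le_prod (fun j _ ↦ by positivity) fun j _ ↦ ?_
        refine Real.rpow_le_rpow_of_nonpos (by positivity) ?_ (by linarith)
        gcongr
        exact Finset.single_le_sum (f := fun j ↦ (m j : ℝ)) (fun _ _ ↦ by positivity)
          (Finset.mem_univ j)

/-- The product `∏ᵢ yᵢ ^ (-(s + kᵢ))`. -/
noncomputable def weight {l : ℕ} (k : Fin l → ℕ) (y : Fin l → ℝ) (s : ℂ) : ℂ :=
  ∏ i, Complex.exp (-(s + k i) * (Real.log (y i) : ℂ))

/-- The values at `m` of the linear forms with coefficients `A` and constant terms `c`. -/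
def forms {l r : ℕ} (A : Fin l → Fin r → ℝ) (c : Fin l → ℝ) (m : Fin r → ℕ) : Fin l → ℝ :=
  fun i ↦ c i + ∑ j, A i j * m j

/-- The general term of the shifted Shintani series. -/
noncomputable def term {l r : ℕ} (A : Fin l → Fin r → ℝ) (χ : Fin r → ℂ) (k : Fin l → ℕ)
    (c : Fin l → ℝ) (s : ℂ) (m : Fin r → ℕ) : ℂ :=
  (∏ j, χ j ^ m j) * weight k (forms A c m) s

/-- The Shintani series `∑ₘ χ ^ m ∏ᵢ (cᵢ + ∑ⱼ aᵢⱼ mⱼ) ^ (-(s + kᵢ))`. -/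
noncomputable def series {l r : ℕ} (A : Fin l → Fin r → ℝ) (χ : Fin r → ℂ) (k : Fin l → ℕ)
    (c : Fin l → ℝ) (s : ℂ) : ℂ :=
  ∑' m, term A χ k c s m

section Weight

variable {l r : ℕ} {A : Fin l → Fin r → ℝ} {χ : Fin r → ℂ} {k : Fin l → ℕ}

lemma norm_weight (k : Fin l → ℕ) (y : Fin l → ℝ) (s : ℂ) :
    ‖weight k y s‖ = Real.exp (-∑ i, (s.re + k i) * Real.log (y i)) := by
  rw [weight, norm_prod, ← Finset.sum_neg_distrib, Real.exp_sum]
  refine Finset.prod_congr rfl fun i _ ↦ ?_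
  rw [Complex.norm_exp, Complex.re_mul_ofReal, ← neg_mul]
  simp

lemma continuousAt_weight {y : Fin l → ℝ} (hy : ∀ i, 0 < y i) (s : ℂ) :
    ContinuousAt (fun p : (Fin l → ℝ) × ℂ ↦ weight k p.1 p.2) (y, s) := by
  unfold weight
  refine tendsto_finsetProd _ fun i _ ↦ ?_
  have h : ContinuousAt (fun p : (Fin l → ℝ) × ℂ ↦ Real.log (p.1 i)) (y, s) :=
    ContinuousAt.log (by fun_prop) (hy i).ne'
  have h' : ContinuousAt (fun p : (Fin l → ℝ) × ℂ ↦ ((Real.log (p.1 i) : ℝ) : ℂ)) (y, s) :=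
    Complex.continuous_ofReal.continuousAt.comp h
  exact (ContinuousAt.mul (by fun_prop) h').cexp

lemma differentiable_weight (y : Fin l → ℝ) : Differentiable ℂ (weight k y) := by
  unfold weight
  fun_prop

lemma weight_add_single (y : Fin l → ℝ) (s : ℂ) {i : Fin l} (hi : 0 < y i) :
    weight (k + Pi.single i 1) y s = ((y i : ℂ))⁻¹ * weight k y s := by
  have h : ∀ j, Complex.exp (-(s + ((k + Pi.single i 1 : Fin l → ℕ) j)) * (Real.log (y j) : ℂ)) =
      (if j = i then ((y i : ℂ))⁻¹ else 1) *
        Complex.exp (-(s + k j) * (Real.log (y j) : ℂ)) := fun j ↦ by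
    split_ifs with hj
    · subst hj
      have : ((y j : ℂ))⁻¹ = Complex.exp (-(Real.log (y j) : ℂ)) := by
        rw [Complex.exp_neg, ← Complex.ofReal_exp, Real.exp_log hi]
      rw [this, ← Complex.exp_add]
      simp only [Pi.add_apply, Pi.single_eq_same]
      push_cast
      ring_nf
    · simp [Pi.single_eq_of_ne hj]
  simp only [weight, h, Finset.prod_mul_distrib]
  simp

lemma hasDerivAt_weight {c v : Fin l → ℝ} {t : ℝ} (h : ∀ i, 0 < c i + t * v i) (s : ℂ) :
    HasDerivAt (fun t : ℝ ↦ weight k (c + t • v) s)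
      (-∑ i, (s + k i) * v i * weight (k + Pi.single i 1) (c + t • v) s) t := by
  have hi : ∀ i ∈ Finset.univ, HasDerivAt
      (fun t : ℝ ↦ Complex.exp (-(s + k i) * (Real.log ((c + t • v) i) : ℂ)))
      (Complex.exp (-(s + k i) * (Real.log ((c + t • v) i) : ℂ)) *
        (-(s + k i) * ((v i / (c + t • v) i : ℝ) : ℂ))) t := fun i _ ↦ by
    have h1 : HasDerivAt (fun t : ℝ ↦ (c + t • v) i) (v i) t := by
      simpa using ((hasDerivAt_id t).mul_const (v i)).const_add (c i)
    exact ((h1.log (h i).ne').ofReal_comp.const_mul _).cexp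
  have := HasDerivAt.fun_finsetProd hi
  refine this.congr_deriv ?_
  rw [← Finset.sum_neg_distrib]
  refine Finset.sum_congr rfl fun i _ ↦ ?_
  rw [weight_add_single _ _ (h i), weight, ← Finset.mul_prod_erase Finset.univ _ (Finset.mem_univ i)]
  simp only [smul_eq_mul, Complex.ofReal_div]
  ring

lemma forms_pos (hA : ∀ i j, 0 < A i j) {c : Fin l → ℝ} (hc : ∀ i, 0 < c i) (m : Fin r → ℕ)
    (i : Fin l) : 0 < forms A c m i :=
  add_pos_of_pos_of_nonneg (hc i) (Finset.sum_nonneg fun j _ ↦ by have := hA i j; positivity)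

lemma forms_add (c v : Fin l → ℝ) (m : Fin r → ℕ) : forms A (c + v) m = forms A c m + v := by
  ext i
  simp only [forms, Pi.add_apply]
  ring

lemma exists_abs_log_forms_sub_le (hA : ∀ i j, 0 < A i j) {c : Fin l → ℝ} (hc : ∀ i, 0 < c i) :
    ∃ K : ℝ, ∀ᶠ c' in 𝓝 c, ∀ m i,
      |Real.log (forms A c' m i) - Real.log (1 + ∑ j, (m j : ℝ))| ≤ K := by
  obtain ⟨q, hq, hqA, hqc⟩ : ∃ q > 0, (∀ i j, q ≤ A i j) ∧ ∀ i, q < c i := by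
    have h1 : ∀ᶠ q : ℝ in 𝓝[>] 0, ∀ i j, q ≤ A i j := by
      simp only [eventually_all]
      exact fun i j ↦ (eventually_le_nhds (hA i j)).filter_mono nhdsWithin_le_nhds
    have h2 : ∀ᶠ q : ℝ in 𝓝[>] 0, ∀ i, q < c i := by
      simp only [eventually_all]
      exact fun i ↦ (eventually_lt_nhds (hc i)).filter_mono nhdsWithin_le_nhds
    obtain ⟨q, hq, h1, h2⟩ := ((eventually_mem_nhdsWithin (a := (0 : ℝ)) (s := Ioi 0)).and (h1.and h2)).exists
    exact ⟨q, hq, h1, h2⟩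
  obtain ⟨Q, hQ, hQA, hQc⟩ : ∃ Q > 0, (∀ i j, A i j ≤ Q) ∧ ∀ i, c i < Q := by
    have h1 : ∀ᶠ Q : ℝ in atTop, ∀ i j, A i j ≤ Q := by
      simp only [eventually_all]
      exact fun i j ↦ eventually_ge_atTop _
    have h2 : ∀ᶠ Q : ℝ in atTop, ∀ i, c i < Q := by
      simp only [eventually_all]
      exact fun i ↦ eventually_gt_atTop _
    obtain ⟨q, hq, h1, h2⟩ := ((eventually_gt_atTop (0 : ℝ)).and (h1.and h2)).exists
    exact ⟨q, hq, h1, h2⟩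
  have hev : ∀ᶠ c' : Fin l → ℝ in 𝓝 c, ∀ i, q < c' i ∧ c' i < Q := by
    simp only [eventually_all]
    exact fun i ↦ (((continuous_apply i).tendsto c).eventually_const_lt (hqc i)).and
      (((continuous_apply i).tendsto c).eventually_lt_const (hQc i))
  refine ⟨max (-Real.log q) (Real.log Q), hev.mono fun c' hc' m i ↦ ?_⟩
  have hM : 0 < 1 + ∑ j, (m j : ℝ) := by positivity
  have hlow : q * (1 + ∑ j, (m j : ℝ)) ≤ forms A c' m i := by
    rw [mul_add, mul_one, Finset.mul_sum]
    exact add_le_add (hc' i).1.le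
      (Finset.sum_le_sum fun j _ ↦ mul_le_mul_of_nonneg_right (hqA i j) (by positivity))
  have hup : forms A c' m i ≤ Q * (1 + ∑ j, (m j : ℝ)) := by
    rw [mul_add, mul_one, Finset.mul_sum]
    exact add_le_add (hc' i).2.le
      (Finset.sum_le_sum fun j _ ↦ mul_le_mul_of_nonneg_right (hQA i j) (by positivity))
  have h1 := Real.log_le_log (by positivity) hlow
  have h2 := Real.log_le_log (lt_of_lt_of_le (by positivity) hlow) hup
  rw [Real.log_mul hq.ne' hM.ne'] at h1
  rw [Real.log_mul hQ.ne' hM.ne'] at h2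
  rw [abs_le]
  constructor
  · linarith [le_max_left (-Real.log q) (Real.log Q)]
  · linarith [le_max_right (-Real.log q) (Real.log Q)]

lemma exists_summable_bound (hA : ∀ i j, 0 < A i j) (hχ : ∀ j, ‖χ j‖ ≤ 1) (k : Fin l → ℕ)
    {c : Fin l → ℝ} (hc : ∀ i, 0 < c i) {s : ℂ} (hs : (r : ℝ) < l * s.re + ∑ i, (k i : ℝ)) :
    ∃ u : (Fin r → ℕ) → ℝ, Summable u ∧
      ∀ᶠ p : (Fin l → ℝ) × ℂ in 𝓝 (c, s), ∀ m, ‖term A χ k p.1 p.2 m‖ ≤ u m := by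
  obtain ⟨K, hK⟩ := exists_abs_log_forms_sub_le hA hc
  obtain ⟨q, hq, hqs⟩ := exists_between hs
  have h1 : ∀ᶠ z : ℂ in 𝓝 s, q < l * z.re + ∑ i, (k i : ℝ) :=
    ((by fun_prop : Continuous fun z : ℂ ↦ l * z.re + ∑ i, (k i : ℝ)).tendsto s).eventually_const_lt
      hqs
  have h2 : ∀ᶠ z : ℂ in 𝓝 s, (∑ i, |z.re + k i| < ∑ i, |s.re + k i| + 1) :=
    ((by fun_prop : Continuous fun z : ℂ ↦ ∑ i, |z.re + k i|).tendsto s).eventually_lt_const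
      (lt_add_one _)
  refine ⟨fun m ↦ Real.exp ((∑ i, |s.re + k i| + 1) * K) * (1 + ∑ j, (m j : ℝ)) ^ (-q),
    (summable_one_add_sum_rpow r hq).mul_left _, ?_⟩
  rw [nhds_prod_eq]
  refine (hK.prod_mk (h1.and h2)).mono fun p hp m ↦ ?_
  obtain ⟨hp, hp1, hp2⟩ := hp
  have hM : 1 ≤ 1 + ∑ j, (m j : ℝ) := le_add_of_nonneg_right (by positivity)
  have hL := Real.log_nonneg hM
  have hχm : ‖∏ j, χ j ^ m j‖ ≤ 1 := by
    rw [norm_prod]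
    refine Finset.prod_le_one (fun _ _ ↦ norm_nonneg _) fun j _ ↦ ?_
    rw [norm_pow]
    exact pow_le_one₀ (norm_nonneg _) (hχ j)
  rw [term, norm_mul]
  refine (mul_le_of_le_one_left (norm_nonneg _) hχm).trans ?_
  beta_reduce
  rw [norm_weight, Real.rpow_def_of_pos (by linarith), ← Real.exp_add, Real.exp_le_exp]
  set L := Real.log (1 + ∑ j, (m j : ℝ))
  have hterm : ∀ i, -((p.2.re + k i) * Real.log (forms A p.1 m i)) ≤
      |p.2.re + k i| * K - (p.2.re + k i) * L := fun i ↦ by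
    have h3 := neg_abs_le ((p.2.re + k i) * (Real.log (forms A p.1 m i) - L))
    rw [abs_mul] at h3
    have h4 := mul_le_mul_of_nonneg_left (hp m i) (abs_nonneg (p.2.re + k i))
    linarith
  have hsum := Finset.sum_le_sum fun i (_ : i ∈ Finset.univ) ↦ hterm i
  rw [Finset.sum_neg_distrib, Finset.sum_sub_distrib, ← Finset.sum_mul, ← Finset.sum_mul,
    Finset.sum_add_distrib, Finset.sum_const, Finset.card_univ, Fintype.card_fin,
    nsmul_eq_mul] at hsum
  have h5 := mul_le_mul_of_nonneg_right hp1.le hL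
  rcases isEmpty_or_nonempty (Fin l) with hl | ⟨⟨i⟩⟩
  · obtain rfl : l = 0 := by
      by_contra h
      exact hl.false ⟨0, Nat.pos_of_ne_zero h⟩
    simp only [CharP.cast_eq_zero, zero_mul, Finset.univ_eq_empty, Finset.sum_empty, add_zero] at hp1
    linarith [(Nat.cast_nonneg r : (0 : ℝ) ≤ r)]
  have hK0 : 0 ≤ K := (abs_nonneg _).trans (hp m i)
  have h6 := mul_le_mul_of_nonneg_right hp2.le hK0
  linarith

lemma summable_term (hA : ∀ i j, 0 < A i j) (hχ : ∀ j, ‖χ j‖ ≤ 1) (k : Fin l → ℕ)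
    {c : Fin l → ℝ} (hc : ∀ i, 0 < c i) {s : ℂ} (hs : (r : ℝ) < l * s.re + ∑ i, (k i : ℝ)) :
    Summable (term A χ k c s) := by
  obtain ⟨u, hu, h⟩ := exists_summable_bound hA hχ k hc hs
  exact hu.of_norm_bounded h.self_of_nhds

lemma continuousAt_series (hA : ∀ i j, 0 < A i j) (hχ : ∀ j, ‖χ j‖ ≤ 1) (k : Fin l → ℕ)
    {c : Fin l → ℝ} (hc : ∀ i, 0 < c i) {s : ℂ} (hs : (r : ℝ) < l * s.re + ∑ i, (k i : ℝ)) :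
    ContinuousAt (Function.uncurry (series A χ k)) (c, s) := by
  obtain ⟨u, hu, h⟩ := exists_summable_bound hA hχ k hc hs
  change Tendsto (fun p : (Fin l → ℝ) × ℂ ↦ ∑' m, term A χ k p.1 p.2 m) (𝓝 (c, s))
    (𝓝 (∑' m, term A χ k c s m))
  refine tendsto_tsum_of_dominated_convergence hu (fun m ↦ ?_) h
  have hforms : Continuous fun p : (Fin l → ℝ) × ℂ ↦ (forms A p.1 m, p.2) := by
    unfold forms
    fun_prop
  exact ((continuousAt_weight (forms_pos hA hc m) s).tendsto.comp
    (hforms.tendsto (c, s))).const_mul _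

lemma differentiableAt_series (hA : ∀ i j, 0 < A i j) (hχ : ∀ j, ‖χ j‖ ≤ 1) (k : Fin l → ℕ)
    {c : Fin l → ℝ} (hc : ∀ i, 0 < c i) {s : ℂ} (hs : (r : ℝ) < l * s.re + ∑ i, (k i : ℝ)) :
    DifferentiableAt ℂ (series A χ k c) s := by
  obtain ⟨u, hu, h⟩ := exists_summable_bound hA hχ k hc hs
  have hz : ∀ᶠ z : ℂ in 𝓝 s, ∀ m, ‖term A χ k c z m‖ ≤ u m :=
    ((by fun_prop : Continuous fun z : ℂ ↦ (c, z)).tendsto s).eventually h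
  obtain ⟨U, hU, hUo, hsU⟩ := eventually_nhds_iff.1 hz
  refine DifferentiableOn.differentiableAt (s := U) ?_ (hUo.mem_nhds hsU)
  exact Complex.differentiableOn_tsum_of_summable_norm hu
    (fun m ↦ ((differentiable_weight _).const_mul _).differentiableOn) hUo fun m z hz ↦ hU z hz m

lemma sum_add_single (k : Fin l → ℕ) (i : Fin l) :
    ∑ j, (((k + Pi.single i 1 : Fin l → ℕ) j) : ℝ) = ∑ j, (k j : ℝ) + 1 := by
  have : ∑ j, (k + Pi.single i 1 : Fin l → ℕ) j = ∑ j, k j + 1 := by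
    simp [Finset.sum_add_distrib]
  exact_mod_cast this

lemma hasDerivAt_series (hA : ∀ i j, 0 < A i j) (hχ : ∀ j, ‖χ j‖ ≤ 1) (k : Fin l → ℕ)
    {c v : Fin l → ℝ} {t : ℝ} (h : ∀ i, 0 < (c + t • v) i) {s : ℂ}
    (hs : (r : ℝ) < l * s.re + ∑ i, (k i : ℝ)) :
    HasDerivAt (fun t : ℝ ↦ series A χ k (c + t • v) s)
      (-∑ i, (s + k i) * v i * series A χ (k + Pi.single i 1) (c + t • v) s) t := by
  have hs' : ∀ i, (r : ℝ) < l * s.re + ∑ j, (((k + Pi.single i 1 : Fin l → ℕ) j) : ℝ) := fun i ↦ by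
    rw [sum_add_single]
    linarith
  choose u hu hb using fun i ↦ exists_summable_bound hA hχ (k + Pi.single i 1) h (hs' i)
  have hcont : Tendsto (fun t : ℝ ↦ (c + t • v, s)) (𝓝 t) (𝓝 (c + t • v, s)) :=
    (by fun_prop : Continuous fun t : ℝ ↦ (c + t • v, s)).tendsto t
  have hb' : ∀ᶠ t' : ℝ in 𝓝 t, ∀ i m,
      ‖term A χ (k + Pi.single i 1) (c + t' • v) s m‖ ≤ u i m := by
    rw [eventually_all]
    exact fun i ↦ hcont.eventually (hb i)
  have hpos : ∀ᶠ t' : ℝ in 𝓝 t, ∀ i, 0 < (c + t' • v) i := by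
    rw [eventually_all]
    exact fun i ↦ ((by fun_prop : Continuous fun t' : ℝ ↦ (c + t' • v) i).tendsto t).eventually_const_lt
      (h i)
  obtain ⟨δ, hδ, hball⟩ := Metric.eventually_nhds_iff_ball.1 (hb'.and hpos)
  have ht : t ∈ Metric.ball t δ := Metric.mem_ball_self hδ
  have key := hasDerivAt_tsum_of_isPreconnected
    (g := fun m (t : ℝ) ↦ term A χ k (c + t • v) s m)
    (g' := fun m t ↦ -∑ i, (s + k i) * v i * term A χ (k + Pi.single i 1) (c + t • v) s m)
    (summable_sum fun i (_ : i ∈ Finset.univ) ↦ (hu i).mul_left ‖(s + k i) * (v i : ℂ)‖)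
    Metric.isOpen_ball (convex_ball t δ).isPreconnected (fun m y hy ↦ ?_) (fun m y hy ↦ ?_) ht
    (summable_term hA hχ k h hs) ht
  · refine key.congr_deriv ?_
    rw [tsum_neg, Summable.tsum_finsetSum fun i _ ↦ (summable_term hA hχ _ h (hs' i)).mul_left _]
    simp only [tsum_mul_left, series]
  · simp only [term, forms_add]
    refine ((hasDerivAt_weight (k := k) (fun i ↦ ?_) s).const_mul _).congr_deriv ?_
    · have := forms_pos hA (hball y hy).2 m i
      rwa [forms_add] at this
    · rw [mul_neg, Finset.mul_sum]
      refine congrArg _ (Finset.sum_congr rfl fun i _ ↦ ?_)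
      ring
  · rw [norm_neg]
    refine (norm_sum_le _ _).trans (Finset.sum_le_sum fun i _ ↦ ?_)
    rw [norm_mul]
    exact mul_le_mul_of_nonneg_left ((hball y hy).1 i m) (norm_nonneg _)

end Weight
section Continuation

variable {l r : ℕ}

lemma forms_cons (A : Fin l → Fin (r + 1) → ℝ) (c : Fin l → ℝ) (n : ℕ) (m : Fin r → ℕ) :
    forms A c (Fin.cons n m : Fin (r + 1) → ℕ) =
      forms (fun i j ↦ A i j.succ) (c + (n : ℝ) • fun i ↦ A i 0) m := by
  ext i
  simp only [forms, Fin.sum_univ_succ, Fin.cons_zero, Fin.cons_succ, Pi.add_apply, Pi.smul_apply,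
    smul_eq_mul]
  ring

lemma term_cons (A : Fin l → Fin (r + 1) → ℝ) (χ : Fin (r + 1) → ℂ) (k : Fin l → ℕ)
    (c : Fin l → ℝ) (s : ℂ) (n : ℕ) (m : Fin r → ℕ) :
    term A χ k c s (Fin.cons n m : Fin (r + 1) → ℕ) =
      χ 0 ^ n * term (fun i j ↦ A i j.succ) (fun j ↦ χ j.succ) k
        (c + (n : ℝ) • fun i ↦ A i 0) s m := by
  rw [term, term, forms_cons, Fin.prod_univ_succ]
  simp only [Fin.cons_zero, Fin.cons_succ, mul_assoc]

lemma series_eq_tsum {A : Fin l → Fin (r + 1) → ℝ} {χ : Fin (r + 1) → ℂ} {k : Fin l → ℕ}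
    {c : Fin l → ℝ} {s : ℂ} (h : Summable (term A χ k c s)) :
    Summable (fun n : ℕ ↦ χ 0 ^ n * series (fun i j ↦ A i j.succ) (fun j ↦ χ j.succ) k
        (c + (n : ℝ) • fun i ↦ A i 0) s) ∧
      series A χ k c s = ∑' n : ℕ, χ 0 ^ n * series (fun i j ↦ A i j.succ) (fun j ↦ χ j.succ) k
        (c + (n : ℝ) • fun i ↦ A i 0) s := by
  have h' := (Fin.consEquiv fun _ : Fin (r + 1) ↦ ℕ).summable_iff.2 h
  have hsum : ∀ n : ℕ, ∑' m : Fin r → ℕ, term A χ k c s (Fin.cons n m : Fin (r + 1) → ℕ) =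
      χ 0 ^ n * series (fun i j ↦ A i j.succ) (fun j ↦ χ j.succ) k
        (c + (n : ℝ) • fun i ↦ A i 0) s := fun n ↦ by
    simp only [term_cons, tsum_mul_left, series]
  constructor
  · exact h'.prod.congr hsum
  · rw [series, ← (Fin.consEquiv fun _ : Fin (r + 1) ↦ ℕ).tsum_eq]
    exact h'.tsum_prod.trans (tsum_congr hsum)

lemma series_eq_add {A : Fin l → Fin (r + 1) → ℝ} {χ : Fin (r + 1) → ℂ} {k : Fin l → ℕ}
    {c : Fin l → ℝ} {s : ℂ} (h : Summable (term A χ k c s))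
    (h' : Summable (term A χ k (c + fun i ↦ A i 0) s)) :
    series A χ k c s = series (fun i j ↦ A i j.succ) (fun j ↦ χ j.succ) k c s +
      χ 0 * series A χ k (c + fun i ↦ A i 0) s := by
  obtain ⟨h1, h2⟩ := series_eq_tsum h
  rw [h2, h1.tsum_eq_zero_add, (series_eq_tsum h').2, ← tsum_mul_left]
  congr 1
  · simp
  · refine tsum_congr fun n ↦ ?_
    have : c + ((n + 1 : ℕ) : ℝ) • (fun i ↦ A i 0) =
        (c + fun i ↦ A i 0) + (n : ℝ) • (fun i ↦ A i 0) := by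
      push_cast
      rw [add_smul, one_smul, add_right_comm, add_assoc]
    rw [this, pow_succ']
    ring

/-- `Z` continues the Shintani series to the half-plane `r - N < l * s.re + ∑ i, k i`. -/
def IsContinuation (N : ℕ) (A : Fin l → Fin r → ℝ) (χ : Fin r → ℂ) (k : Fin l → ℕ)
    (Z : (Fin l → ℝ) → ℂ → ℂ) : Prop :=
  ∀ c : Fin l → ℝ, (∀ i, 0 < c i) → ∀ s : ℂ,
    ((r : ℝ) - N < l * s.re + ∑ i, (k i : ℝ) →
      ContinuousAt (Function.uncurry Z) (c, s) ∧ DifferentiableAt ℂ (Z c) s) ∧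
    ((r : ℝ) < l * s.re + ∑ i, (k i : ℝ) → Z c s = series A χ k c s)

lemma isContinuation_series {A : Fin l → Fin r → ℝ} (hA : ∀ i j, 0 < A i j) {χ : Fin r → ℂ}
    (hχ : ∀ j, ‖χ j‖ ≤ 1) (k : Fin l → ℕ) : IsContinuation 0 A χ k (series A χ k) := by
  refine fun c hc s ↦ ⟨fun hs ↦ ?_, fun _ ↦ rfl⟩
  rw [Nat.cast_zero, sub_zero] at hs
  exact ⟨continuousAt_series hA hχ k hc hs, differentiableAt_series hA hχ k hc hs⟩

lemma isContinuation_weight (N : ℕ) (A : Fin l → Fin 0 → ℝ) (χ : Fin 0 → ℂ) (k : Fin l → ℕ) :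
    IsContinuation N A χ k (weight k) := by
  refine fun c hc s ↦ ⟨fun _ ↦ ⟨continuousAt_weight hc s, differentiable_weight c s⟩, fun _ ↦ ?_⟩
  rw [series, tsum_eq_single default fun m hm ↦ absurd (Subsingleton.elim m _) hm, term]
  have : forms A c default = c := by
    ext i
    simp [forms]
  rw [this, Fin.prod_univ_zero, one_mul]

lemma add_smul_pos {c v : Fin l → ℝ} (hc : ∀ i, 0 < c i) (hv : ∀ i, 0 < v i) {t : ℝ}
    (ht : 0 ≤ t) (i : Fin l) : 0 < (c + t • v) i :=
  add_pos_of_pos_of_nonneg (hc i) (mul_nonneg ht (hv i).le)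

lemma IsContinuation.intervalIntegral {N : ℕ} {A : Fin l → Fin r → ℝ} {χ : Fin r → ℂ}
    {k : Fin l → ℕ} {Z : (Fin l → ℝ) → ℂ → ℂ} (hZ : IsContinuation N A χ k Z) {c v : Fin l → ℝ}
    (hc : ∀ i, 0 < c i) (hv : ∀ i, 0 < v i) {s : ℂ}
    (hs : (r : ℝ) - N < l * s.re + ∑ i, (k i : ℝ)) :
    ContinuousAt (fun p : (Fin l → ℝ) × ℂ ↦ ∫ t in (0 : ℝ)..1, Z (p.1 + t • v) p.2) (c, s) ∧
      DifferentiableAt ℂ (fun s ↦ ∫ t in (0 : ℝ)..1, Z (c + t • v) s) s := by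
  have hs' : ∀ᶠ z : ℂ in 𝓝 s, (r : ℝ) - N < l * z.re + ∑ i, (k i : ℝ) :=
    ((by fun_prop : Continuous fun z : ℂ ↦ l * z.re + ∑ i, (k i : ℝ)).tendsto s).eventually_const_lt
      hs
  have hc' : ∀ᶠ c' : Fin l → ℝ in 𝓝 c, ∀ i, 0 < c' i := by
    rw [eventually_all]
    exact fun i ↦ ((continuous_apply i).tendsto c).eventually_const_lt (hc i)
  constructor
  · refine continuousAt_intervalIntegral
      (F := fun (p : (Fin l → ℝ) × ℂ) (t : ℝ) ↦ Z (p.1 + t • v) p.2) ?_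
    rw [nhds_prod_eq]
    refine (hc'.prod_mk hs').mono fun p hp t ht ↦ ?_
    have hcont : Continuous fun q : ((Fin l → ℝ) × ℂ) × ℝ ↦ (q.1.1 + q.2 • v, q.1.2) := by
      fun_prop
    exact (hZ _ (add_smul_pos hp.1 hv ht.1) p.2).1 hp.2 |>.1.tendsto.comp (hcont.tendsto (p, t))
  · refine differentiableAt_intervalIntegral (F := fun (z : ℂ) (t : ℝ) ↦ Z (c + t • v) z)
      (hs'.mono fun z hz t ht ↦ ?_)
    obtain ⟨h1, h2⟩ := (hZ _ (add_smul_pos hc hv ht.1) z).1 hz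
    have hcont : Continuous fun q : ℂ × ℝ ↦ (c + q.2 • v, q.1) := by fun_prop
    exact ⟨h1.tendsto.comp (hcont.tendsto (z, t)), h2⟩

lemma series_eq_integral {A : Fin l → Fin (r + 1) → ℝ} (hA : ∀ i j, 0 < A i j)
    {χ : Fin (r + 1) → ℂ} (hχ : ∀ j, ‖χ j‖ ≤ 1) (hχ1 : χ 0 ≠ 1) (k : Fin l → ℕ) {c : Fin l → ℝ}
    (hc : ∀ i, 0 < c i) {s : ℂ} (hs : ((r + 1 : ℕ) : ℝ) < l * s.re + ∑ i, (k i : ℝ)) :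
    series A χ k c s = (1 - χ 0)⁻¹ * (series (fun i j ↦ A i j.succ) (fun j ↦ χ j.succ) k c s -
      χ 0 * ∑ i, (s + k i) * A i 0 *
        ∫ t in (0 : ℝ)..1, series A χ (k + Pi.single i 1) (c + t • fun i ↦ A i 0) s) := by
  have hv : ∀ i, 0 < A i 0 := fun i ↦ hA i 0
  have hcont : ∀ i, ContinuousOn
      (fun t : ℝ ↦ series A χ (k + Pi.single i 1) (c + t • fun i ↦ A i 0) s) (uIcc 0 1) :=
    fun i t ht ↦ by
      rw [uIcc_of_le zero_le_one] at ht
      exact (hasDerivAt_series hA hχ (k + Pi.single i 1) (s := s) (add_smul_pos hc hv ht.1)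
        (by rw [sum_add_single]; linarith)).continuousAt.continuousWithinAt
  have hint : ∀ i ∈ (Finset.univ : Finset (Fin l)), IntervalIntegrable
      (fun t : ℝ ↦ (s + k i) * A i 0 * series A χ (k + Pi.single i 1) (c + t • fun i ↦ A i 0) s)
      volume 0 1 := fun i _ ↦ ((hcont i).intervalIntegrable).const_mul _
  have hder : IntervalIntegrable (fun t : ℝ ↦ -∑ i, (s + k i) * A i 0 *
      series A χ (k + Pi.single i 1) (c + t • fun i ↦ A i 0) s) volume 0 1 :=
    (ContinuousOn.neg (continuousOn_finsetSum _ fun i _ ↦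
      (hcont i).const_mul _)).intervalIntegrable
  have hftc := intervalIntegral.integral_eq_sub_of_hasDerivAt (a := 0) (b := 1)
    (f := fun t : ℝ ↦ series A χ k (c + t • fun i ↦ A i 0) s)
    (fun t ht ↦ hasDerivAt_series hA hχ k (s := s) (add_smul_pos hc hv (by
      rw [uIcc_of_le zero_le_one] at ht
      exact ht.1)) hs) hder
  rw [intervalIntegral.integral_neg, intervalIntegral.integral_finsetSum hint] at hftc
  simp only [intervalIntegral.integral_const_mul, one_smul, zero_smul, add_zero] at hftc
  have hsplit := series_eq_add (summable_term hA hχ k hc hs)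
    (summable_term hA hχ k (c := c + fun i ↦ A i 0) (fun i ↦ add_pos (hc i) (hv i)) hs)
  have h1 : 1 - χ 0 ≠ 0 := sub_ne_zero.2 hχ1.symm
  rw [eq_inv_mul_iff_mul_eq₀ h1]
  linear_combination hsplit - χ 0 * hftc

lemma IsContinuation.succ {N : ℕ} {A : Fin l → Fin (r + 1) → ℝ} (hA : ∀ i j, 0 < A i j)
    {χ : Fin (r + 1) → ℂ} (hχ : ∀ j, ‖χ j‖ ≤ 1) (hχ1 : χ 0 ≠ 1) {k : Fin l → ℕ}
    {B : (Fin l → ℝ) → ℂ → ℂ} {Z : Fin l → (Fin l → ℝ) → ℂ → ℂ}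
    (hB : IsContinuation N (fun i j ↦ A i (Fin.succ j)) (fun j ↦ χ j.succ) k B)
    (hZ : ∀ i, IsContinuation N A χ (k + Pi.single i 1) (Z i)) :
    IsContinuation (N + 1) A χ k fun c s ↦ (1 - χ 0)⁻¹ * (B c s -
      χ 0 * ∑ i, (s + k i) * A i 0 * ∫ t in (0 : ℝ)..1, Z i (c + t • fun i ↦ A i 0) s) := by
  have hv : ∀ i, 0 < A i 0 := fun i ↦ hA i 0
  refine fun c hc s ↦ ⟨fun hs ↦ ?_, fun hs ↦ ?_⟩
  · push_cast at hs
    obtain ⟨hBc, hBd⟩ := (hB c hc s).1 (by linarith)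
    have hI := fun i ↦ (hZ i).intervalIntegral hc hv (s := s) (by
      rw [sum_add_single]; push_cast; linarith)
    constructor
    · refine (hBc.sub (continuousAt_const.mul (tendsto_finsetSum _ fun i _ ↦ ?_))).const_mul _
      exact ContinuousAt.mul (f := fun p : (Fin l → ℝ) × ℂ ↦ (p.2 + k i) * (A i 0 : ℂ))
        (by fun_prop) (hI i).1
    · refine (hBd.sub ((DifferentiableAt.fun_sum fun i _ ↦ ?_).const_mul _)).const_mul _
      exact DifferentiableAt.mul (by fun_prop) (hI i).2
  · rw [series_eq_integral hA hχ hχ1 k hc hs]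
    push_cast at hs
    beta_reduce
    rw [(hB c hc s).2 (by linarith)]
    congr 3
    refine Finset.sum_congr rfl fun i _ ↦ congrArg _ (intervalIntegral.integral_congr fun t ht ↦ ?_)
    rw [uIcc_of_le zero_le_one] at ht
    refine (hZ i _ (add_smul_pos hc hv ht.1) s).2 ?_
    rw [sum_add_single]
    push_cast
    linarith

theorem exists_isContinuation (N : ℕ) : ∀ {r : ℕ} {A : Fin l → Fin r → ℝ},
    (∀ i j, 0 < A i j) → ∀ {χ : Fin r → ℂ}, (∀ j, ‖χ j‖ ≤ 1) → (∀ j, χ j ≠ 1) →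
      ∀ k : Fin l → ℕ, ∃ Z, IsContinuation N A χ k Z := by
  induction N with
  | zero => exact fun hA _ hχ _ k ↦ ⟨_, isContinuation_series hA hχ k⟩
  | succ N ih =>
    intro r A hA χ hχ hχ1 k
    cases r with
    | zero => exact ⟨_, isContinuation_weight _ A χ k⟩
    | succ r =>
      obtain ⟨B, hB⟩ := ih (A := fun i j ↦ A i (Fin.succ j)) (fun i j ↦ hA i _)
        (χ := fun j ↦ χ j.succ) (fun j ↦ hχ _) (fun j ↦ hχ1 _) k
      choose Z hZ using fun i ↦ ih hA hχ hχ1 (k + Pi.single i 1)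
      exact ⟨_, hB.succ hA hχ (hχ1 0) hZ⟩

end Continuation

/-- Compatible continuations to the half-planes `σ - N < s.re` glue to an entire function. -/
lemma exists_entire_of_forall_halfPlane {g : ℂ → ℂ} {σ : ℝ} {f : ℕ → ℂ → ℂ}
    (hf : ∀ N : ℕ, ∀ s : ℂ, σ - N < s.re → DifferentiableAt ℂ (f N) s)
    (hg : ∀ N, ∀ s : ℂ, σ < s.re → f N s = g s) :
    ∃ F : ℂ → ℂ, Differentiable ℂ F ∧ ∀ s : ℂ, σ < s.re → F s = g s := by
  have hopen : ∀ a : ℝ, IsOpen {s : ℂ | a < s.re} := fun a ↦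
    isOpen_lt continuous_const Complex.continuous_re
  have heq : ∀ N M : ℕ, N ≤ M → ∀ s : ℂ, σ - N < s.re → f N s = f M s := fun N M hNM s hs ↦ by
    have hNM' : (N : ℝ) ≤ M := by exact_mod_cast hNM
    have han : ∀ n, n = N ∨ n = M → AnalyticOnNhd ℂ (f n) {s : ℂ | σ - N < s.re} := fun n hn ↦
      DifferentiableOn.analyticOnNhd (fun z hz ↦ (hf n z (by
        rcases hn with rfl | rfl
        · exact hz
        · rw [mem_ofPred_eq] at hz
          linarith)).differentiableWithinAt) (hopen _)
    refine (han N (.inl rfl)).eqOn_of_preconnected_of_eventuallyEq (han M (.inr rfl))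
      (convex_halfSpace_re_gt _).isPreconnected (z₀ := ((σ + 1 : ℝ) : ℂ)) ?_ ?_ hs
    · rw [mem_ofPred_eq, Complex.ofReal_re]
      linarith [(Nat.cast_nonneg N : (0 : ℝ) ≤ N)]
    · filter_upwards [(hopen σ).mem_nhds (show σ < (((σ + 1 : ℝ) : ℂ)).re by simp)] with z hz
      rw [hg N z hz, hg M z hz]
  choose n hn using fun s : ℂ ↦ exists_nat_gt (σ - s.re)
  have key : ∀ N : ℕ, ∀ s : ℂ, σ - N < s.re → f (n s) s = f N s := fun N s hs ↦ by
    rcases le_total N (n s) with h | h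
    · exact (heq _ _ h s hs).symm
    · exact heq _ _ h s (by linarith [hn s])
  refine ⟨fun s ↦ f (n s) s, fun s ↦ ?_, fun s hs ↦ hg _ s hs⟩
  have hs : σ - n s < s.re := by linarith [hn s]
  refine (hf (n s) s hs).congr_of_eventuallyEq ?_
  filter_upwards [(hopen _).mem_nhds hs] with z hz using key _ z hz

end Shintani

/-- If each `χ_j` is a root of unity different from `1`, then Shintani's
multiple zeta series `ζ(s, A, x, χ)` extends to an entire function. -/
theorem shintani_zeta_entire_continuation (l r : ℕ) (hl : 1 ≤ l) (hr : 1 ≤ r)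
    (A : Fin l → Fin r → ℝ) (hA : ∀ i j, 0 < A i j)
    (x : Fin r → ℝ) (hx : ∀ j, 0 < x j)
    (χ : Fin r → ℂ) (hχroot : ∀ j, ∃ n : ℕ, 0 < n ∧ χ j ^ n = 1) (hχne : ∀ j, χ j ≠ 1) :
    ∃ f : ℂ → ℂ, (∀ s : ℂ, AnalyticAt ℂ f s) ∧
      ∀ s : ℂ, (r : ℝ) / (l : ℝ) < s.re →
        f s = ∑' m : Fin r → ℕ,
          (∏ j, χ j ^ m j) *
            ∏ i, Complex.exp (-s * (Real.log (∑ j, A i j * ((m j : ℝ) + x j)) : ℂ)) := by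
  have hl' : (0 : ℝ) < l := by exact_mod_cast hl
  have hχ : ∀ j, ‖χ j‖ ≤ 1 := fun j ↦ by
    obtain ⟨n, hn, h⟩ := hχroot j
    exact (Complex.norm_eq_one_of_pow_eq_one h hn.ne').le
  choose Z hZ using fun N : ℕ ↦ Shintani.exists_isContinuation (l * N) hA hχ hχne (fun _ ↦ 0)
  have hc : ∀ i, 0 < ∑ j, A i j * x j := fun i ↦
    Finset.sum_pos (fun j _ ↦ mul_pos (hA i j) (hx j)) ⟨⟨0, hr⟩, Finset.mem_univ _⟩
  obtain ⟨f, hf, hfZ⟩ := Shintani.exists_entire_of_forall_halfPlane (σ := (r : ℝ) / l)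
    (f := fun N ↦ Z N fun i ↦ ∑ j, A i j * x j)
    (g := Shintani.series A χ (fun _ ↦ 0) fun i ↦ ∑ j, A i j * x j)
    (fun N s hs ↦ ((hZ N _ hc s).1 (by
      rw [sub_lt_iff_lt_add, div_lt_iff₀ hl'] at hs
      push_cast
      simp only [Finset.sum_const_zero]
      linarith)).2)
    (fun N s hs ↦ (hZ N _ hc s).2 (by
      rw [div_lt_iff₀ hl'] at hs
      simp only [Nat.cast_zero, Finset.sum_const_zero]
      linarith))
  refine ⟨f, fun s ↦ hf.analyticAt s, fun s hs ↦ ?_⟩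
  rw [hfZ s hs, Shintani.series]
  refine tsum_congr fun m ↦ ?_
  rw [Shintani.term, Shintani.weight]
  refine congrArg _ (Finset.prod_congr rfl fun i _ ↦ ?_)
  rw [Shintani.forms, ← Finset.sum_add_distrib]
  simp only [Nat.cast_zero, add_zero, mul_add, add_comm]
end

section
/- (Cassou-Noguès) Let r ≥ 1, k ≥ 0 be integers, z ∈ ℝ_{>0}, v ∈ ℝ_{>0}^r, and let ξ_1, …, ξ_r ∈ ℂ be roots of unity with ξ_j ≠ 1 for all j. Let U ⊆ ℂ be a connected open set containing −k and the half-plane {s : Re(s) > r}, and let f be analytic on U with f(s) = ∑_{m ∈ (ℤ_{≥0})^r} (∏_{j=1}^r ξ_j^{m_j}) (z + m_1 v_1 + … + m_r v_r)^{−s} for Re(s) > r. Then f(−k) = ∑_{m ∈ (ℤ_{≥1})^r, m_1+…+m_r ≤ k+r} (1−ξ)^{−m} ∑_{l : 1 ≤ l_i ≤ m_i} {m; l} · (z − l_1 v_1 − … − l_r v_r)^k; moreover the inner sum ∑_{l} {m; l} (z − l·v)^k vanishes whenever m_1 + … + m_r > k + r, so the restriction of the outer sum loses no terms. -/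
namespace CassouNogues

open Filter Topology Asymptotics Set

theorem dvd_prod_sub_prod {ι R : Type*} [CommRing R] {x : R} (s : Finset ι) {f g : ι → R}
    (h : ∀ i ∈ s, x ∣ f i - g i) : x ∣ ∏ i ∈ s, f i - ∏ i ∈ s, g i := by
  classical
  induction s using Finset.induction_on with
  | empty => simp
  | insert a s ha ih =>
    have h1 := ((h a (Finset.mem_insert_self a s)).mul_right (∏ i ∈ s, f i)).add
      ((ih fun i hi => h i (Finset.mem_insert_of_mem hi)).mul_left (g a))
    rw [Finset.prod_insert ha, Finset.prod_insert ha]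
    convert h1 using 1
    ring

theorem hasSum_prod_pi {𝕜 α : Type*} [NormedField 𝕜] [CompleteSpace 𝕜] {r : ℕ}
    {f : Fin r → α → 𝕜} (hf : ∀ i, Summable fun n => ‖f i n‖) :
    (Summable fun m : Fin r → α => ‖∏ i, f i (m i)‖) ∧
      HasSum (fun m : Fin r → α => ∏ i, f i (m i)) (∏ i, ∑' n, f i n) := by
  induction r with
  | zero =>
    refine ⟨(hasSum_fintype _).summable, ?_⟩
    simp
  | succ r ih =>
    obtain ⟨h1, h2⟩ := ih (f := fun i => f i.succ) fun i => hf i.succ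
    rw [← (Fin.consEquiv (fun _ : Fin (r + 1) => α)).summable_iff,
      ← (Fin.consEquiv (fun _ : Fin (r + 1) => α)).hasSum_iff]
    have h3 := (hf 0).mul_norm h1
    have h0 : Summable (f 0) := (hf 0).of_norm
    constructor
    · refine h3.congr fun x => ?_
      simp [Fin.prod_univ_succ, Fin.consEquiv]
    · rw [Fin.prod_univ_succ]
      refine (h0.hasSum.mul h2 h3.of_norm).congr_fun fun x => ?_
      simp [Fin.prod_univ_succ, Fin.consEquiv]

theorem isBigO_prod_sub_prod {ι α : Type*} {l : Filter α} (s : Finset ι) {f g : ι → α → ℂ}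
    {b : α → ℝ} (hf : ∀ i, f i =O[l] fun _ => (1 : ℝ)) (hg : ∀ i, g i =O[l] fun _ => (1 : ℝ))
    (h : ∀ i, (fun t => f i t - g i t) =O[l] b) :
    (fun t => ∏ i ∈ s, f i t - ∏ i ∈ s, g i t) =O[l] b := by
  classical
  have hP : ∀ (u : ι → α → ℂ) (s : Finset ι), (∀ i, u i =O[l] fun _ => (1 : ℝ)) →
      (fun t => ∏ i ∈ s, u i t) =O[l] fun _ => (1 : ℝ) := by
    intro u s hu
    simpa using IsBigO.finsetProd (s := s) (g := fun _ _ => (1 : ℝ)) fun i _ => hu i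
  induction s using Finset.induction_on with
  | empty => simpa using isBigO_zero _ _
  | insert a s ha ih =>
    have := (((hP f s hf).mul (h a)).add ((hg a).mul ih))
    simp only [one_mul] at this
    refine this.congr_left fun t => ?_
    rw [Finset.prod_insert ha, Finset.prod_insert ha]
    ring

/-- Uniqueness of analytic continuation when the competitor is only available on arbitrarily large
half-planes: a path from `a` to the half-plane of agreement lies in one of them. -/
theorem eq_of_eqOn_halfPlane {U : Set ℂ} (hUopen : IsOpen U) (hUconn : IsConnected U)
    {r : ℝ} (hUhp : {s : ℂ | r < s.re} ⊆ U) {f : ℂ → ℂ} (hf : AnalyticOnNhd ℂ f U)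
    {a w : ℂ} (ha : a ∈ U)
    (h : ∀ B : ℝ, ∃ N > B, ∃ F : ℂ → ℂ, DifferentiableOn ℂ F {s : ℂ | -N < s.re} ∧
      (∀ s : ℂ, r < s.re → f s = F s) ∧ F a = w) : f a = w := by
  have hb : ((r + 1 : ℝ) : ℂ) ∈ {s : ℂ | r < s.re} := by simp
  have hpc : IsPathConnected U := (hUopen.isConnected_iff_isPathConnected).1 hUconn
  obtain ⟨γ, hγ⟩ := hpc.joinedIn _ ha _ (hUhp hb)
  obtain ⟨C, hC⟩ := (isCompact_range γ.continuous).isBounded.exists_norm_le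
  obtain ⟨N, hN, F, hF, hfF, rfl⟩ := h C
  have hsub : range γ ⊆ U ∩ {s : ℂ | -N < s.re} := by
    rintro _ ⟨t, rfl⟩
    refine ⟨hγ t, ?_⟩
    have h1 := hC _ (mem_range_self t)
    have h2 := (abs_le.1 (Complex.abs_re_le_norm (γ t))).1
    change -N < (γ t).re
    linarith
  have hVo : IsOpen {s : ℂ | -N < s.re} := isOpen_lt continuous_const Complex.continuous_re
  have hrange : IsPreconnected (range γ) := isPreconnected_range γ.continuous
  have hstart : a ∈ range γ := ⟨0, γ.source⟩
  set K := connectedComponentIn (U ∩ {s : ℂ | -N < s.re}) a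
  have hKsub : K ⊆ U ∩ {s : ℂ | -N < s.re} := connectedComponentIn_subset _ _
  have hγK : range γ ⊆ K := hrange.subset_connectedComponentIn hstart hsub
  have hb' : ((r + 1 : ℝ) : ℂ) ∈ K := hγK ⟨1, γ.target⟩
  have hFa : AnalyticOnNhd ℂ F {s : ℂ | -N < s.re} := hF.analyticOnNhd hVo
  refine (hf.mono (hKsub.trans inter_subset_left)).eqOn_of_preconnected_of_eventuallyEq
    (hFa.mono (hKsub.trans inter_subset_right)) isPreconnected_connectedComponentIn hb' ?_
    (hγK hstart)
  filter_upwards [(isOpen_lt continuous_const Complex.continuous_re).mem_nhds hb] with s hs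
  exact hfF s hs

/-- Polynomial inverse of `1 - ξ X` modulo a power of `1 - X`. -/
theorem exists_polynomial_inverse {ξ : ℂ} (hξ : ξ ≠ 1) (N : ℕ) :
    ∃ P Q : Polynomial ℂ, (1 - Polynomial.C ξ * Polynomial.X) * P
      + (1 - Polynomial.X) ^ N * Q = 1 := by
  have hc : IsCoprime (1 - Polynomial.C ξ * Polynomial.X : Polynomial ℂ) (1 - Polynomial.X) := by
    refine ⟨Polynomial.C (1 - ξ)⁻¹, - Polynomial.C ((1 - ξ)⁻¹ * ξ), ?_⟩
    have : (Polynomial.C (1 - ξ)⁻¹ * Polynomial.C (1 - ξ) : Polynomial ℂ) = 1 := by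
      rw [← Polynomial.C_mul, inv_mul_cancel₀ (sub_ne_zero.2 hξ.symm), Polynomial.C_1]
    rw [Polynomial.C_mul]
    rw [Polynomial.C_sub, Polynomial.C_1] at this
    linear_combination this
  obtain ⟨P, Q, h⟩ := hc.pow_right (n := N)
  exact ⟨P, Q, by linear_combination h⟩

theorem one_sub_mul_ne_zero {ξ : ℂ} (hξ : ‖ξ‖ = 1) (hξ1 : ξ ≠ 1) {y : ℝ} (hy : y ∈ Icc (0 : ℝ) 1) :
    1 - ξ * y ≠ 0 := by
  intro h
  have h1 : ξ * y = 1 := (sub_eq_zero.1 h).symm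
  have h2 : y = 1 := by
    have := congrArg norm h1
    simpa [hξ, abs_of_nonneg hy.1] using this
  exact hξ1 (by simpa [h2] using h1)

theorem isBigO_comp_exp {ψ : ℝ → ℂ} (hψ : ContinuousOn ψ (Icc 0 1)) {v : ℝ} (hv : 0 ≤ v) :
    (fun t : ℝ => ψ (Real.exp (-v * t))) =O[𝓟 (Ioi 0)] fun _ => (1 : ℝ) := by
  obtain ⟨C, hC⟩ := isCompact_Icc.exists_bound_of_continuousOn hψ
  refine isBigO_principal.2 ⟨C, fun t ht => ?_⟩
  simp only [norm_one, mul_one]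
  refine hC _ ⟨(Real.exp_pos _).le, Real.exp_le_one_iff.2 ?_⟩
  nlinarith [mem_Ioi.1 ht]

theorem isBigO_one_sub_exp_pow {v : ℝ} (hv : 0 ≤ v) (N : ℕ) :
    (fun t : ℝ => (1 - (Real.exp (-v * t) : ℂ)) ^ N) =O[𝓟 (Ioi 0)] fun t => t ^ N := by
  refine IsBigO.pow (isBigO_principal.2 ⟨v, fun t ht => ?_⟩) N
  have ht : 0 < t := ht
  have h1 : Real.exp (-v * t) ≤ 1 := Real.exp_le_one_iff.2 (by nlinarith)
  have h2 := Real.add_one_le_exp (-v * t)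
  rw [← Complex.ofReal_one, ← Complex.ofReal_sub, Complex.norm_real, Real.norm_of_nonneg (by linarith),
    Real.norm_of_nonneg ht.le]
  linarith

theorem summable_rpow {r : ℕ} (hr : 1 ≤ r) {z : ℝ} (hz : 0 < z) {v : Fin r → ℝ}
    (hv : ∀ i, 0 < v i) {σ : ℝ} (hσ : r < σ) :
    Summable fun m : Fin r → ℕ => 1 / (z + ∑ i, (m i : ℝ) * v i) ^ σ := by
  have hr0 : (0 : ℝ) < r := by exact_mod_cast hr
  have hσr : 1 < σ / r := (one_lt_div hr0).2 hσ
  have hc : ∀ i, 0 < min z (v i) := fun i => lt_min hz (hv i)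
  have hs : ∀ i : Fin r, Summable fun n : ℕ => ‖1 / (min z (v i) * (n + 1)) ^ (σ / r)‖ := by
    intro i
    have h1 := ((summable_nat_add_iff 1).2 (Real.summable_one_div_nat_rpow.2 hσr)).mul_left
      (1 / (min z (v i)) ^ (σ / r))
    refine h1.congr fun n => ?_
    have := hc i
    rw [Real.norm_of_nonneg (by positivity), Real.mul_rpow (hc i).le (by positivity)]
    push_cast
    field_simp
  refine Summable.of_nonneg_of_le (fun m => ?_) (fun m => ?_) (hasSum_prod_pi hs).2.summable
  · have : 0 ≤ ∑ i, (m i : ℝ) * v i := Finset.sum_nonneg fun i _ => by have := hv i; positivity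
    positivity
  · have hS : 0 ≤ ∑ i, (m i : ℝ) * v i := Finset.sum_nonneg fun i _ => by have := hv i; positivity
    have hp : ∀ i, min z (v i) * (m i + 1) ≤ z + ∑ i, (m i : ℝ) * v i := by
      intro i
      have h1 : (m i : ℝ) * v i ≤ ∑ i, (m i : ℝ) * v i :=
        Finset.single_le_sum (f := fun i => (m i : ℝ) * v i)
          (fun i _ => by have := hv i; positivity) (Finset.mem_univ i)
      nlinarith [min_le_left z (v i), min_le_right z (v i), (m i).cast_nonneg (α := ℝ)]
    have h2 : ∏ i, (min z (v i) * (m i + 1)) ^ (σ / r) ≤ (z + ∑ i, (m i : ℝ) * v i) ^ σ := by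
      calc _ ≤ ∏ i : Fin r, (z + ∑ i, (m i : ℝ) * v i) ^ (σ / r) :=
            Finset.prod_le_prod (fun i _ => by have := hc i; positivity) fun i _ =>
              Real.rpow_le_rpow (by have := hc i; positivity) (hp i) (by positivity)
        _ = _ := by
          rw [Finset.prod_const, Finset.card_univ, Fintype.card_fin, ← Real.rpow_mul_natCast
            (by positivity), div_mul_cancel₀ _ hr0.ne']
    rw [Finset.prod_div_distrib, Finset.prod_const_one]
    refine one_div_le_one_div_of_le (Finset.prod_pos fun i _ => ?_) h2
    have := hc i; positivity


theorem mellin_tsum {r : ℕ} (hr : 1 ≤ r) {z : ℝ} (hz : 0 < z) {v : Fin r → ℝ}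
    (hv : ∀ i, 0 < v i) {ξ : Fin r → ℂ} (hξ : ∀ i, ‖ξ i‖ = 1) {s : ℂ} (hs : r < s.re) :
    mellin (fun t => (Real.exp (-z * t) : ℂ) * ∏ i, (1 - ξ i * Real.exp (-v i * t))⁻¹) s =
      Complex.Gamma s * ∑' m : Fin r → ℕ,
        (∏ j, ξ j ^ m j) * Complex.exp (-s * (Real.log (z + ∑ i, (m i : ℝ) * v i) : ℂ)) := by
  have hp : ∀ m : Fin r → ℕ, 0 < z + ∑ i, (m i : ℝ) * v i := fun m => by
    have : 0 ≤ ∑ i, (m i : ℝ) * v i := Finset.sum_nonneg fun i _ => by have := hv i; positivity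
    positivity
  have hs0 : 0 < s.re := lt_of_le_of_lt (Nat.cast_nonneg r) hs
  have h := hasSum_mellin (a := fun m : Fin r → ℕ => ∏ j, ξ j ^ m j)
    (p := fun m => z + ∑ i, (m i : ℝ) * v i)
    (F := fun t => (Real.exp (-z * t) : ℂ) * ∏ i, (1 - ξ i * Real.exp (-v i * t))⁻¹)
    (fun m => Or.inr (hp m)) hs0 (fun t ht => ?_) ?_
  · rw [← h.tsum_eq, ← tsum_mul_left]
    refine tsum_congr fun m => ?_
    rw [Complex.cpow_def_of_ne_zero (by exact_mod_cast (hp m).ne'), Complex.ofReal_log (hp m).le,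
      mul_div_assoc, div_eq_mul_inv, ← Complex.exp_neg]
    congr 3
    ring
  · have hn : ∀ i, ‖ξ i * Real.exp (-v i * t)‖ < 1 := fun i => by
      rw [norm_mul, hξ, one_mul, Complex.norm_real, Real.norm_of_nonneg (Real.exp_pos _).le,
        Real.exp_lt_one_iff]
      nlinarith [hv i, mem_Ioi.1 ht]
    have h1 := (hasSum_prod_pi (f := fun (i : Fin r) (n : ℕ) => (ξ i * Real.exp (-v i * t)) ^ n)
      fun i => (summable_geometric_of_lt_one (norm_nonneg _) (hn i)).congr fun n =>
        (norm_pow _ _).symm).2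
    simp_rw [tsum_geometric_of_norm_lt_one (hn _)] at h1
    refine (h1.mul_left (Real.exp (-z * t) : ℂ)).congr_fun fun m => ?_
    simp_rw [mul_pow, Finset.prod_mul_distrib]
    rw [mul_left_comm]
    congr 1
    simp_rw [← Complex.ofReal_pow, ← Complex.ofReal_prod, ← Complex.ofReal_mul, ← Real.exp_nat_mul,
      ← Real.exp_sum, ← Real.exp_add]
    congr 2
    rw [neg_add, add_mul, ← Finset.sum_neg_distrib, Finset.sum_mul]
    congr 1
    exact Finset.sum_congr rfl fun i _ => by ring
  · refine (summable_rpow hr hz hv hs).congr fun m => ?_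
    simp [norm_prod, hξ]

theorem mellin_exp_polynomial {r : ℕ} {z : ℝ} (hz : 0 < z) {v : Fin r → ℝ}
    (hv : ∀ i, 0 < v i) (P : Fin r → Polynomial ℂ) {s : ℂ} (hs : 0 < s.re) :
    mellin (fun t => (Real.exp (-z * t) : ℂ) * ∏ i, (P i).eval (Real.exp (-v i * t) : ℂ)) s =
      Complex.Gamma s * ∑ l ∈ Fintype.piFinset fun i => Finset.range ((P i).natDegree + 1),
        (∏ j, (P j).coeff (l j)) *
          Complex.exp (-s * (Real.log (z + ∑ i, (l i : ℝ) * v i) : ℂ)) := by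
  have hp : ∀ m : Fin r → ℕ, 0 < z + ∑ i, (m i : ℝ) * v i := fun m => by
    have : 0 ≤ ∑ i, (m i : ℝ) * v i := Finset.sum_nonneg fun i _ => by have := hv i; positivity
    positivity
  have h := hasSum_mellin
    (ι := (Fintype.piFinset fun i => Finset.range ((P i).natDegree + 1) : Finset (Fin r → ℕ)))
    (a := fun l => ∏ j, (P j).coeff (l.1 j))
    (p := fun m => z + ∑ i, (m.1 i : ℝ) * v i)
    (F := fun t => (Real.exp (-z * t) : ℂ) * ∏ i, (P i).eval (Real.exp (-v i * t) : ℂ))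
    (fun m => Or.inr (hp m)) hs (fun t ht => ?_) Summable.of_finite
  · rw [← h.tsum_eq, tsum_fintype, Finset.mul_sum]
    refine Eq.trans ?_ (Finset.sum_coe_sort _ _)
    refine Finset.sum_congr rfl fun m _ => ?_
    rw [Complex.cpow_def_of_ne_zero (by exact_mod_cast (hp m).ne'), Complex.ofReal_log (hp m).le,
      mul_div_assoc, div_eq_mul_inv, ← Complex.exp_neg]
    congr 3
    ring
  · have key : ∀ m : Fin r → ℕ,
        (∏ i, (P i).coeff (m i)) * (Real.exp (-(z + ∑ i, (m i : ℝ) * v i) * t) : ℂ) =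
          (Real.exp (-z * t) : ℂ) * ∏ i, (P i).coeff (m i) * (Real.exp (-v i * t) : ℂ) ^ m i := by
      intro m
      rw [Finset.prod_mul_distrib, mul_left_comm]
      congr 1
      simp_rw [← Complex.ofReal_pow, ← Complex.ofReal_prod, ← Complex.ofReal_mul,
        ← Real.exp_nat_mul, ← Real.exp_sum, ← Real.exp_add]
      congr 2
      rw [neg_add, add_mul, ← Finset.sum_neg_distrib, Finset.sum_mul]
      congr 1
      exact Finset.sum_congr rfl fun i _ => by ring
    simp_rw [key, Polynomial.eval_eq_sum_range]
    rw [Finset.prod_univ_sum, Finset.mul_sum, ← Finset.sum_coe_sort]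
    exact hasSum_fintype _

theorem exists_continuation {r : ℕ} (hr : 1 ≤ r) {z : ℝ} (hz : 0 < z) {v : Fin r → ℝ}
    (hv : ∀ i, 0 < v i) {ξ : Fin r → ℂ} (hξ : ∀ i, ‖ξ i‖ = 1) (hξ1 : ∀ i, ξ i ≠ 1)
    {N : ℕ} {P Q : Fin r → Polynomial ℂ}
    (hPQ : ∀ i, (1 - Polynomial.C (ξ i) * Polynomial.X) * P i
      + (1 - Polynomial.X) ^ N * Q i = 1) :
    ∃ F : ℂ → ℂ, DifferentiableOn ℂ F {s : ℂ | -(N : ℝ) < s.re} ∧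
      (∀ s : ℂ, r < s.re → ∑' m : Fin r → ℕ,
        (∏ j, ξ j ^ m j) * Complex.exp (-s * (Real.log (z + ∑ i, (m i : ℝ) * v i) : ℂ)) = F s) ∧
      ∀ k : ℕ, F (-k) = ∑ l ∈ Fintype.piFinset fun i => Finset.range ((P i).natDegree + 1),
        (∏ j, (P j).coeff (l j)) * ((z + ∑ i, (l i : ℝ) * v i : ℝ) : ℂ) ^ k := by
  have hp : ∀ m : Fin r → ℕ, 0 < z + ∑ i, (m i : ℝ) * v i := fun m => by
    have : 0 ≤ ∑ i, (m i : ℝ) * v i := Finset.sum_nonneg fun i _ => by have := hv i; positivity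
    positivity
  set G₁ : ℝ → ℂ := fun t => ∏ i, (1 - ξ i * Real.exp (-v i * t))⁻¹ with hG₁
  set E₁ : ℝ → ℂ := fun t => ∏ i, (P i).eval (Real.exp (-v i * t) : ℂ) with hE₁
  set e : ℝ → ℂ := fun t => (Real.exp (-z * t) : ℂ) with he
  have hgc : ∀ i, ContinuousOn (fun y : ℝ => (1 - ξ i * y)⁻¹) (Icc 0 1) := fun i =>
    ContinuousOn.inv₀ (by fun_prop) fun y hy => one_sub_mul_ne_zero (hξ i) (hξ1 i) hy
  have hPc : ∀ i, ContinuousOn (fun y : ℝ => (P i).eval (y : ℂ)) (Icc 0 1) := fun i => by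
    fun_prop
  have hQc : ∀ i, ContinuousOn (fun y : ℝ => (1 - ξ i * y)⁻¹ * (Q i).eval (y : ℂ)) (Icc 0 1) :=
    fun i => (hgc i).mul (by fun_prop)
  have hg := fun i => isBigO_comp_exp (hgc i) (hv i).le
  have hP := fun i => isBigO_comp_exp (hPc i) (hv i).le
  have hQ := fun i => isBigO_comp_exp (hQc i) (hv i).le
  have hmem : ∀ i, ∀ t ∈ Ioi (0 : ℝ), Real.exp (-v i * t) ∈ Icc (0 : ℝ) 1 := fun i t ht =>
    ⟨(Real.exp_pos _).le, Real.exp_le_one_iff.2 (by nlinarith [hv i, mem_Ioi.1 ht])⟩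
  have hd : ∀ i, (fun t : ℝ => (1 - ξ i * Real.exp (-v i * t))⁻¹ -
      (P i).eval (Real.exp (-v i * t) : ℂ)) =O[𝓟 (Ioi 0)] fun t => t ^ N := fun i => by
    have h1 := (hQ i).mul (isBigO_one_sub_exp_pow (hv i).le N)
    simp only [one_mul] at h1
    refine h1.congr' ?_ EventuallyEq.rfl
    filter_upwards [mem_principal_self _] with t ht
    have h2 := one_sub_mul_ne_zero (hξ i) (hξ1 i) (hmem i t ht)
    have h3 := congrArg (Polynomial.eval (Real.exp (-v i * t) : ℂ)) (hPQ i)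
    simp only [Polynomial.eval_add, Polynomial.eval_mul, Polynomial.eval_sub, Polynomial.eval_one,
      Polynomial.eval_C, Polynomial.eval_X, Polynomial.eval_pow] at h3
    rw [mul_assoc, mul_comm (Polynomial.eval _ _), ← sub_eq_iff_eq_add'.2 h3.symm, mul_sub, mul_one,
      inv_mul_cancel_left₀ h2]
  have hdiff := isBigO_prod_sub_prod Finset.univ hg hP hd
  have hprod : ∀ u : Fin r → ℝ → ℂ, (∀ i, u i =O[𝓟 (Ioi 0)] fun _ => (1 : ℝ)) →
      (fun t => ∏ i, u i t) =O[𝓟 (Ioi 0)] fun _ => (1 : ℝ) := fun u hu => by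
    simpa using IsBigO.finsetProd (s := Finset.univ) (g := fun _ _ => (1 : ℝ)) fun i _ => hu i
  have heO : e =O[𝓟 (Ioi 0)] fun t => Real.exp (-z * t) :=
    isBigO_of_le _ fun t => by simp only [he, Complex.norm_real, le_refl]
  have he1 : e =O[𝓟 (Ioi 0)] fun _ => (1 : ℝ) :=
    isBigO_comp_exp (ψ := fun y => (y : ℂ)) (by fun_prop) hz.le
  have hec : Continuous e := by fun_prop
  have htop : atTop ≤ 𝓟 (Ioi (0 : ℝ)) := le_principal_iff.2 (Ioi_mem_atTop 0)
  have hzero : 𝓝[>] (0 : ℝ) ≤ 𝓟 (Ioi (0 : ℝ)) := inf_le_right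
  have hGO := hprod _ hg
  have hEO := hprod _ hP
  have hGc : ContinuousOn G₁ (Ioi 0) := continuousOn_finsetProd _ fun i _ =>
    (hgc i).comp (f := fun t => Real.exp (-v i * t)) (by fun_prop) (hmem i)
  have hEc : ContinuousOn E₁ (Ioi 0) := continuousOn_finsetProd _ fun i _ =>
    (hPc i).comp (f := fun t => Real.exp (-v i * t)) (by fun_prop) (hmem i)
  have hloc : ∀ u : ℝ → ℂ, ContinuousOn u (Ioi 0) →
      MeasureTheory.LocallyIntegrableOn (fun t => e t * u t) (Ioi 0) := fun u hu =>
    (hec.continuousOn.mul hu).locallyIntegrableOn measurableSet_Ioi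
  have hexp : ∀ u : ℝ → ℂ, u =O[𝓟 (Ioi 0)] (fun _ => (1 : ℝ)) →
      (fun t => e t * u t) =O[atTop] fun t => Real.exp (-z * t) := fun u hu => by
    simpa using (heO.mul hu).mono htop
  have hconv : ∀ u : ℝ → ℂ, ContinuousOn u (Ioi 0) → u =O[𝓟 (Ioi 0)] (fun _ => (1 : ℝ)) →
      ∀ s : ℂ, 0 < s.re → MellinConvergent (fun t => e t * u t) s := fun u hu hu1 s hs =>
    mellinConvergent_of_isBigO_rpow_exp hz (hloc u hu) (hexp u hu1)
      (b := 0) (by simpa using (he1.mul hu1).mono hzero) hs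
  refine ⟨fun s => ∑ l ∈ Fintype.piFinset fun i => Finset.range ((P i).natDegree + 1),
        (∏ j, (P j).coeff (l j)) * Complex.exp (-s * (Real.log (z + ∑ i, (l i : ℝ) * v i) : ℂ))
      + mellin (fun t => e t * (G₁ t - E₁ t)) s * (Complex.Gamma s)⁻¹, ?_, ?_, ?_⟩
  · refine DifferentiableOn.add (by fun_prop) (DifferentiableOn.mul (fun s hs => ?_)
      Complex.differentiable_one_div_Gamma.differentiableOn)
    refine (mellin_differentiableAt_of_isBigO_rpow_exp hz (hloc _ (hGc.sub hEc))
      (hexp _ (hGO.sub hEO)) (b := -N) ?_ hs).differentiableWithinAt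
    exact ((he1.mul hdiff).mono hzero).congr_right fun t => by simp
  · intro s hs
    have hs0 : 0 < s.re := lt_of_le_of_lt (Nat.cast_nonneg r) hs
    have hΓ := Complex.Gamma_ne_zero_of_re_pos hs0
    simp_rw [mul_sub]
    rw [(hasMellin_sub (hconv _ hGc hGO s hs0) (hconv _ hEc hEO s hs0)).2,
      mellin_tsum hr hz hv hξ hs, mellin_exp_polynomial hz hv P hs0]
    field_simp
    ring
  · intro k
    simp only [Complex.Gamma_neg_nat_eq_zero, inv_zero, mul_zero, add_zero, neg_neg]
    refine Finset.sum_congr rfl fun l _ => ?_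
    rw [← Complex.ofReal_natCast, ← Complex.ofReal_mul, ← Complex.ofReal_exp,
      ← Complex.ofReal_pow, mul_comm (k : ℝ), ← Real.rpow_def_of_pos (hp l), Real.rpow_natCast]

/-- The power series `exp (a X)`. -/
noncomputable def expSeries (a : ℂ) : PowerSeries ℂ :=
  PowerSeries.rescale a (PowerSeries.exp ℂ)

theorem expSeries_add (a b : ℂ) : expSeries (a + b) = expSeries a * expSeries b :=
  (PowerSeries.exp_mul_exp_eq_exp_add a b).symm

theorem expSeries_zero : expSeries 0 = 1 := by
  simp [expSeries]

theorem expSeries_sum {ι : Type*} (s : Finset ι) (a : ι → ℂ) :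
    expSeries (∑ i ∈ s, a i) = ∏ i ∈ s, expSeries (a i) := by
  classical
  induction s using Finset.induction_on with
  | empty => simp [expSeries_zero]
  | insert i s hi ih => rw [Finset.sum_insert hi, Finset.prod_insert hi, expSeries_add, ih]

theorem expSeries_pow (a : ℂ) (n : ℕ) : expSeries a ^ n = expSeries (n * a) := by
  simpa using (expSeries_sum (Finset.range n) fun _ => a).symm

theorem coeff_expSeries (a : ℂ) (k : ℕ) :
    PowerSeries.coeff k (expSeries a) = a ^ k * (k.factorial : ℂ)⁻¹ := by
  simp [expSeries, PowerSeries.coeff_rescale, PowerSeries.coeff_exp]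

theorem X_dvd_one_sub_expSeries (a : ℂ) : (PowerSeries.X : PowerSeries ℂ) ∣ 1 - expSeries a := by
  rw [PowerSeries.X_dvd_iff, map_sub, ← PowerSeries.coeff_zero_eq_constantCoeff_apply _ ,
    ← PowerSeries.coeff_zero_eq_constantCoeff_apply, coeff_expSeries]
  simp

theorem sum_Icc_one {M : Type*} [AddCommMonoid M] (g : ℕ → M) (n : ℕ) :
    ∑ l ∈ Finset.Icc 1 n, g l = ∑ j ∈ Finset.range n, g (j + 1) := by
  rw [Finset.range_eq_Ico, Finset.sum_Ico_add' g 0 n 1, zero_add, Finset.Ico_add_one_right_eq_Icc]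

theorem sum_choose_mul_expSeries {m : ℕ} (hm : 1 ≤ m) (a : ℂ) :
    ∑ l ∈ Finset.Icc 1 m, PowerSeries.C ((-1 : ℂ) ^ (l - 1) * ((m - 1).choose (l - 1) : ℂ)) *
      expSeries (-(l * a)) = expSeries (-a) * (1 - expSeries (-a)) ^ (m - 1) := by
  obtain ⟨n, rfl⟩ := Nat.exists_eq_add_of_le' hm
  rw [sum_Icc_one, sub_eq_neg_add, add_pow, Finset.mul_sum]
  refine Finset.sum_congr rfl fun j _ => ?_
  have h : expSeries (-((j + 1 : ℕ) * a)) = expSeries (-a) * expSeries (-a) ^ j := by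
    rw [expSeries_pow, ← expSeries_add]
    congr 1
    push_cast
    ring
  rw [h, neg_pow (expSeries (-a))]
  simp only [Nat.add_sub_cancel, map_mul, map_pow, map_neg, map_one, map_natCast, one_pow]
  ring

/-- The `k`-th coefficient of a product of exponential polynomials. -/
theorem sum_piFinset_mul_pow {r : ℕ} (k : ℕ) (z : ℂ) (s : Fin r → Finset ℕ) (c : Fin r → ℕ → ℂ)
    (w : Fin r → ℕ → ℂ) :
    ∑ l ∈ Fintype.piFinset s, (∏ i, c i (l i)) * (z + ∑ i, w i (l i)) ^ k =
      k.factorial * PowerSeries.coeff k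
        (expSeries z * ∏ i, ∑ l ∈ s i, PowerSeries.C (c i l) * expSeries (w i l)) := by
  rw [Finset.prod_univ_sum, Finset.mul_sum, map_sum, Finset.mul_sum]
  refine Finset.sum_congr rfl fun l _ => ?_
  rw [Finset.prod_mul_distrib, ← expSeries_sum, mul_left_comm, ← expSeries_add, ← map_prod,
    PowerSeries.coeff_C_mul, coeff_expSeries]
  have := Nat.cast_ne_zero (R := ℂ).2 k.factorial_ne_zero
  field_simp

theorem sum_choose_mul_pow {r : ℕ} (k : ℕ) (z : ℝ) (v : Fin r → ℝ) {m : Fin r → ℕ}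
    (hm : ∀ i, 1 ≤ m i) :
    ∑ l ∈ Fintype.piFinset fun i => Finset.Icc 1 (m i),
        (∏ i, (-1 : ℂ) ^ (l i - 1) * ((m i - 1).choose (l i - 1) : ℂ)) *
          (((z - ∑ i, (l i : ℝ) * v i : ℝ) : ℂ)) ^ k =
      k.factorial * PowerSeries.coeff k
        (expSeries z * ∏ i, (expSeries (-v i) * (1 - expSeries (-v i)) ^ (m i - 1))) := by
  simp_rw [← fun i => sum_choose_mul_expSeries (hm i) (v i)]
  rw [← sum_piFinset_mul_pow k (z : ℂ) (fun i => Finset.Icc 1 (m i))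
    (fun i l => (-1 : ℂ) ^ (l - 1) * ((m i - 1).choose (l - 1) : ℂ))
    (fun i l => -((l : ℂ) * (v i : ℂ)))]
  refine Finset.sum_congr rfl fun l _ => ?_
  push_cast
  rw [Finset.sum_neg_distrib, sub_eq_add_neg]

theorem sum_choose_mul_pow_eq_zero {r k : ℕ} (z : ℝ) (v : Fin r → ℝ) {m : Fin r → ℕ}
    (hm : ∀ i, 1 ≤ m i) (hk : k + r < ∑ i, m i) :
    ∑ l ∈ Fintype.piFinset fun i => Finset.Icc 1 (m i),
        (∏ i, (-1 : ℂ) ^ (l i - 1) * ((m i - 1).choose (l i - 1) : ℂ)) *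
          (((z - ∑ i, (l i : ℝ) * v i : ℝ) : ℂ)) ^ k = 0 := by
  have hsum : ∑ i, m i = ∑ i, (m i - 1) + r := by
    rw [← Finset.sum_congr rfl fun i _ => Nat.sub_add_cancel (hm i), Finset.sum_add_distrib]
    simp
  have hdvd : (PowerSeries.X : PowerSeries ℂ) ^ (∑ i, (m i - 1)) ∣
      expSeries z * ∏ i, (expSeries (-v i) * (1 - expSeries (-v i)) ^ (m i - 1)) := by
    rw [← Finset.prod_pow_eq_pow_sum]
    exact (Finset.prod_dvd_prod_of_dvd _ _ fun i _ =>
      (pow_dvd_pow_of_dvd (X_dvd_one_sub_expSeries _) _).mul_left _).mul_left _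
  rw [sum_choose_mul_pow k z v hm, PowerSeries.X_pow_dvd_iff.1 hdvd k (by omega), mul_zero]

theorem X_pow_dvd_sum_sub_aeval {ξ : ℂ} (hξ : ξ ≠ 1) (a : ℂ) {n M N : ℕ} (hM : n ≤ M)
    (hN : n ≤ N) {P Q : Polynomial ℂ}
    (hPQ : (1 - Polynomial.C ξ * Polynomial.X) * P + (1 - Polynomial.X) ^ N * Q = 1) :
    (PowerSeries.X : PowerSeries ℂ) ^ n ∣
      ∑ m ∈ Finset.Icc 1 M, PowerSeries.C ((1 - ξ) ^ m)⁻¹ *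
        (expSeries (-a) * (1 - expSeries (-a)) ^ (m - 1)) - Polynomial.aeval (expSeries a) P := by
  set S := expSeries a
  set T := expSeries (-a)
  have hST : S * T = 1 := by rw [← expSeries_add, add_neg_cancel, expSeries_zero]
  have hP : (1 - PowerSeries.C ξ * S) * Polynomial.aeval S P +
      (1 - S) ^ N * Polynomial.aeval S Q = 1 := by
    have := congrArg (Polynomial.aeval S) hPQ
    simpa using this
  have hS : (PowerSeries.X : PowerSeries ℂ) ^ n ∣ (1 - S) ^ N :=
    (pow_dvd_pow _ hN).trans (pow_dvd_pow_of_dvd (X_dvd_one_sub_expSeries _) _)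
  have hT : (PowerSeries.X : PowerSeries ℂ) ^ n ∣ (1 - T) ^ M :=
    (pow_dvd_pow _ hM).trans (pow_dvd_pow_of_dvd (X_dvd_one_sub_expSeries _) _)
  have hc : PowerSeries.C (1 - ξ)⁻¹ * (1 - PowerSeries.C ξ) = (1 : PowerSeries ℂ) := by
    rw [← map_one PowerSeries.C, ← map_sub, ← map_mul, inv_mul_cancel₀ (sub_ne_zero.2 hξ.symm)]
  set c : PowerSeries ℂ := PowerSeries.C (1 - ξ)⁻¹
  have hh : (1 - PowerSeries.C ξ * S) * ∑ m ∈ Finset.Icc 1 M, PowerSeries.C ((1 - ξ) ^ m)⁻¹ *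
      (T * (1 - T) ^ (m - 1)) = 1 - c ^ M * (1 - T) ^ M := by
    have hg := mul_neg_geom_sum (c * (1 - T)) M
    rw [← mul_pow, ← hg, sum_Icc_one, Finset.mul_sum, Finset.mul_sum]
    refine Finset.sum_congr rfl fun j _ => ?_
    rw [← inv_pow, map_pow, Nat.add_sub_cancel]
    change _ * (c ^ (j + 1) * _) = _
    rw [mul_pow]
    linear_combination (-(PowerSeries.C ξ) * c ^ (j + 1) * (1 - T) ^ j) * hST +
      (c ^ j * (1 - T) ^ j) * hc
  set H := ∑ m ∈ Finset.Icc 1 M, PowerSeries.C ((1 - ξ) ^ m)⁻¹ * (T * (1 - T) ^ (m - 1))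
  have key : H - Polynomial.aeval S P = (1 - S) ^ N * (Polynomial.aeval S Q * H) -
      (1 - T) ^ M * (c ^ M * Polynomial.aeval S P) := by
    linear_combination (-H) * hP + Polynomial.aeval S P * hh
  rw [key]
  exact (hS.mul_right _).sub (hT.mul_right _)

theorem sum_coeff_mul_pow_eq {r k : ℕ} (hr : 1 ≤ r) (z : ℝ) (v : Fin r → ℝ) {ξ : Fin r → ℂ}
    (hξ : ∀ i, ξ i ≠ 1) {N : ℕ} (hN : k < N) {P Q : Fin r → Polynomial ℂ}
    (hPQ : ∀ i, (1 - Polynomial.C (ξ i) * Polynomial.X) * P i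
      + (1 - Polynomial.X) ^ N * Q i = 1) :
    ∑ l ∈ Fintype.piFinset fun i => Finset.range ((P i).natDegree + 1),
        (∏ j, (P j).coeff (l j)) * ((z + ∑ i, (l i : ℝ) * v i : ℝ) : ℂ) ^ k =
      ∑ m ∈ (Fintype.piFinset fun _ : Fin r => Finset.Icc 1 (k + r)).filter
          (fun m => ∑ i, m i ≤ k + r),
        (∏ i, (1 - ξ i) ^ m i)⁻¹ *
          ∑ l ∈ Fintype.piFinset fun i => Finset.Icc 1 (m i),
            (∏ i, (-1 : ℂ) ^ (l i - 1) * ((m i - 1).choose (l i - 1) : ℂ)) *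
              (((z - ∑ i, (l i : ℝ) * v i : ℝ) : ℂ)) ^ k := by
  have hpos : ∀ m ∈ Fintype.piFinset fun _ : Fin r => Finset.Icc 1 (k + r), ∀ i, 1 ≤ m i :=
    fun m hm i => (Finset.mem_Icc.1 (Fintype.mem_piFinset.1 hm i)).1
  have hR : ∀ m ∈ Fintype.piFinset fun _ : Fin r => Finset.Icc 1 (k + r),
      (∏ i, (1 - ξ i) ^ m i)⁻¹ *
          ∑ l ∈ Fintype.piFinset fun i => Finset.Icc 1 (m i),
            (∏ i, (-1 : ℂ) ^ (l i - 1) * ((m i - 1).choose (l i - 1) : ℂ)) *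
              (((z - ∑ i, (l i : ℝ) * v i : ℝ) : ℂ)) ^ k =
        k.factorial * PowerSeries.coeff k (expSeries z * ∏ i, (PowerSeries.C ((1 - ξ i) ^ m i)⁻¹ *
          (expSeries (-v i) * (1 - expSeries (-v i)) ^ (m i - 1)))) := by
    intro m hm
    rw [sum_choose_mul_pow k z v (hpos m hm), Finset.prod_mul_distrib (f := fun i =>
      PowerSeries.C ((1 - ξ i) ^ m i)⁻¹), ← map_prod, mul_left_comm,
      mul_left_comm (expSeries _), PowerSeries.coeff_C_mul, Finset.prod_inv_distrib]
  rw [Finset.sum_filter_of_ne, Finset.sum_congr rfl hR, ← Finset.mul_sum, ← map_sum,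
    ← Finset.mul_sum, ← Finset.prod_univ_sum (fun _ => Finset.Icc 1 (k + r)) (fun i m =>
      PowerSeries.C ((1 - ξ i) ^ m)⁻¹ * (expSeries (-v i) * (1 - expSeries (-v i)) ^ (m - 1)))]
  · have hL := sum_piFinset_mul_pow k (z : ℂ) (fun i => Finset.range ((P i).natDegree + 1))
      (fun i l => (P i).coeff l) (fun i l => (l : ℂ) * (v i : ℂ))
    have hP : ∀ i, ∑ l ∈ Finset.range ((P i).natDegree + 1),
        PowerSeries.C ((P i).coeff l) * expSeries ((l : ℂ) * (v i : ℂ)) =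
          Polynomial.aeval (expSeries (v i)) (P i) := fun i => by
      rw [Polynomial.aeval_eq_sum_range]
      refine Finset.sum_congr rfl fun l _ => ?_
      rw [expSeries_pow, PowerSeries.smul_eq_C_mul]
    simp_rw [hP] at hL
    push_cast
    rw [hL]
    congr 1
    have hd := (dvd_prod_sub_prod Finset.univ fun i _ => X_pow_dvd_sum_sub_aeval (hξ i) (v i)
      (by omega : k + 1 ≤ k + r) (by omega : k + 1 ≤ N) (hPQ i)).mul_left (expSeries z)
    have := PowerSeries.X_pow_dvd_iff.1 hd k (by omega)
    rw [mul_sub, map_sub, sub_eq_zero] at this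
    exact this.symm
  · intro m hm hne
    by_contra! hlt
    exact hne (by rw [sum_choose_mul_pow_eq_zero z v (hpos m hm) hlt, mul_zero])

end CassouNogues


/-- **Cassou-Noguès.** For the root-of-unity-twisted Barnes-type series
`∑_m (∏_j ξ_j^{m_j}) (z + m·v)^{-s}` with all `ξ_j` roots of unity different from `1`,
any analytic continuation `f` to a connected open set containing `-k` and the half-plane
`Re s > r` satisfies
`f(-k) = ∑_{m ∈ ℤ_{≥1}^r, ∑ m_i ≤ k+r} (1-ξ)^{-m} ∑_{1 ≤ l_i ≤ m_i} {m;l} (z - l·v)^k`,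
and the inner sum vanishes whenever `∑ m_i > k + r`. -/
theorem cassouNogues_value (r k : ℕ) (hr : 1 ≤ r) (z : ℝ) (hz : 0 < z)
    (v : Fin r → ℝ) (hv : ∀ i, 0 < v i)
    (ξ : Fin r → ℂ) (hξroot : ∀ j, ∃ n : ℕ, 0 < n ∧ ξ j ^ n = 1) (hξne : ∀ j, ξ j ≠ 1)
    (U : Set ℂ) (hUopen : IsOpen U) (hUconn : IsConnected U)
    (hUk : (-(k : ℂ)) ∈ U) (hUhp : {s : ℂ | (r : ℝ) < s.re} ⊆ U)
    (f : ℂ → ℂ) (hf : AnalyticOnNhd ℂ f U)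
    (hfs : ∀ s : ℂ, (r : ℝ) < s.re →
      f s = ∑' m : Fin r → ℕ,
        (∏ j, ξ j ^ m j) * Complex.exp (-s * (Real.log (z + ∑ i, (m i : ℝ) * v i) : ℂ))) :
    f (-(k : ℂ)) =
      ∑ m ∈ (Fintype.piFinset fun _ : Fin r => Finset.Icc 1 (k + r)).filter
          (fun m => ∑ i, m i ≤ k + r),
        (∏ i, (1 - ξ i) ^ m i)⁻¹ *
          ∑ l ∈ Fintype.piFinset fun i => Finset.Icc 1 (m i),
            (∏ i, (-1 : ℂ) ^ (l i - 1) * ((m i - 1).choose (l i - 1) : ℂ)) *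
              (((z - ∑ i, (l i : ℝ) * v i : ℝ) : ℂ)) ^ k ∧
    ∀ m : Fin r → ℕ, (∀ i, 1 ≤ m i) → k + r < ∑ i, m i →
      (∑ l ∈ Fintype.piFinset fun i => Finset.Icc 1 (m i),
        (∏ i, (-1 : ℂ) ^ (l i - 1) * ((m i - 1).choose (l i - 1) : ℂ)) *
          (((z - ∑ i, (l i : ℝ) * v i : ℝ) : ℂ)) ^ k) = 0 := by
  have hξ : ∀ j, ‖ξ j‖ = 1 := fun j => by
    obtain ⟨n, hn, h⟩ := hξroot j
    exact Complex.norm_eq_one_of_pow_eq_one h hn.ne'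
  refine ⟨CassouNogues.eq_of_eqOn_halfPlane hUopen hUconn hUhp hf hUk fun B => ?_,
    fun m hm hk => CassouNogues.sum_choose_mul_pow_eq_zero z v hm hk⟩
  obtain ⟨N₀, hN₀⟩ := exists_nat_gt B
  choose P Q hPQ using fun i =>
    CassouNogues.exists_polynomial_inverse (hξne i) (max N₀ (k + 1))
  obtain ⟨F, hF, hfF, hFk⟩ := CassouNogues.exists_continuation hr hz hv hξ hξne hPQ
  exact ⟨(max N₀ (k + 1) : ℕ), hN₀.trans_le (by exact_mod_cast le_max_left _ _), F, hF,
    fun s hs => (hfs s hs).trans (hfF s hs), (hFk k).trans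
      (CassouNogues.sum_coeff_mul_pow_eq hr z v hξne (by omega) hPQ)⟩
end

section
/- (Cassou-Noguès, norm version) Let F be a totally real number field of degree n, and let N = N_{F/ℚ} denote the field norm (which is positive on totally positive elements). Let r ≥ 1, k ≥ 0 be integers, z ∈ F totally positive, v_1, …, v_r ∈ F totally positive, and let ξ_1, …, ξ_r ∈ ℂ be roots of unity with ξ_j ≠ 1 for all j. Let U ⊆ ℂ be a connected open set containing −k and the half-plane {s : Re(s) > r}, and let f be analytic on U with f(s) = ∑_{m ∈ (ℤ_{≥0})^r} (∏_{j=1}^r ξ_j^{m_j}) (N(z + m_1 v_1 + … + m_r v_r))^{−s} for Re(s) > r. Then f(−k) = ∑_{m ∈ (ℤ_{≥1})^r, m_1+…+m_r ≤ nk+r} (1−ξ)^{−m} ∑_{l : 1 ≤ l_i ≤ m_i} {m; l} · N(z − l_1 v_1 − … − l_r v_r)^k, where N(z − l·v) ∈ ℚ ⊆ ℂ; moreover the inner sum ∑_{l} {m; l} N(z − l·v)^k vanishes whenever m_1 + … + m_r > nk + r. -/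
/-- A number field is totally real if every complex embedding takes real values. -/
def IsTotallyRealField (F : Type*) [Field F] : Prop :=
  ∀ φ : F →+* ℂ, ∀ x : F, (φ x).im = 0

/-- Peeling the first coordinate off a sum over a box of tuples. -/
theorem sum_piFinset_succ {A : Type*} [AddCommMonoid A] {r : ℕ} (s : Fin (r + 1) → Finset ℕ)
    (f : (Fin (r + 1) → ℕ) → A) :
    ∑ x ∈ Fintype.piFinset s, f x =
      ∑ x₀ ∈ s 0, ∑ x' ∈ Fintype.piFinset (fun i => s i.succ), f (Fin.cons x₀ x') := by
  rw [← Finset.sum_product']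
  symm
  refine Finset.sum_equiv (Fin.consEquiv fun _ => ℕ) (fun x => ?_) (fun x _ => rfl)
  simp [Fin.consEquiv, Fintype.mem_piFinset, Fin.forall_fin_succ]

/-- The backward difference with step `h`. -/
def bwdDiff {M : Type*} [AddCommGroup M] (h : M) (W : M → ℂ) : M → ℂ := fun a => W a - W (a - h)

/-- The closed form of `(bwdDiff h)^[m - 1] W (a - h)`. -/
def bwdSum {M : Type*} [AddCommGroup M] (h : M) (m : ℕ) (W : M → ℂ) (a : M) : ℂ :=
  ∑ l ∈ Finset.Icc 1 m, (-1 : ℂ) ^ (l - 1) * ((m - 1).choose (l - 1) : ℂ) * W (a - l • h)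

/-- Functions annihilated by any `d` successive forward differences: polynomial maps of degree
less than `d`. -/
def IsPolyMap {M : Type*} [AddCommGroup M] : ℕ → (M → ℂ) → Prop
  | 0, g => g = 0
  | d + 1, g => ∀ h : M, IsPolyMap d (fwdDiff h g)

section Algebraic

variable {M : Type*} [AddCommGroup M]

theorem bwdDiff_iter_eq (h : M) (W : M → ℂ) (q : ℕ) :
    (bwdDiff h)^[q] W = fun a => (-1 : ℂ) ^ q * (fwdDiff (-h))^[q] W a := by
  induction q with
  | zero => simp
  | succ q ih =>
    funext a
    rw [Function.iterate_succ_apply', Function.iterate_succ_apply', ih]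
    simp only [bwdDiff, fwdDiff, sub_eq_add_neg]
    ring

theorem bwdSum_succ_eq_bwdDiff_iter (h : M) (q : ℕ) (W : M → ℂ) (a : M) :
    bwdSum h (q + 1) W a = (bwdDiff h)^[q] W (a - h) := by
  rw [bwdDiff_iter_eq, bwdSum]
  beta_reduce
  rw [fwdDiff_iter_eq_sum_shift, Finset.mul_sum,
    Finset.sum_bij (fun l _ => l - 1) (t := Finset.range (q + 1))]
  · intro l hl
    simp only [Finset.mem_Icc] at hl
    simp only [Finset.mem_range]
    omega
  · intro l hl l' hl' hh
    simp only [Finset.mem_Icc] at hl hl'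
    omega
  · intro l hl
    simp only [Finset.mem_range] at hl
    exact ⟨l + 1, by simp only [Finset.mem_Icc]; omega, rfl⟩
  · intro l hl
    simp only [Finset.mem_Icc] at hl
    obtain ⟨j, rfl⟩ : ∃ j, l = j + 1 := ⟨l - 1, by omega⟩
    obtain ⟨i, rfl⟩ : ∃ i, q = j + i := ⟨q - j, by omega⟩
    have h1 : a - (j + 1) • h = a - h + j • (-h) := by
      rw [succ_nsmul]; simp only [smul_neg]; abel
    have h2 : ((-1 : ℂ) ^ i) * (-1) ^ i = 1 := by rw [← mul_pow]; simp
    simp only [Nat.add_sub_cancel, Nat.add_sub_cancel_left, zsmul_eq_mul, h1]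
    push_cast
    rw [pow_add]
    linear_combination (-(-1 : ℂ) ^ j * ((j + i).choose j : ℂ) * W (a - h + j • (-h))) * h2

theorem sum_pow_mul_bwdSum_sub (h : M) (W : M → ℂ) (ξ : ℂ) (hξ : ξ ≠ 1) (b : ℕ) (a : M) :
    (∑ m ∈ Finset.Icc 1 b, ((1 - ξ) ^ m)⁻¹ * bwdSum h m W a) -
        ξ * (∑ m ∈ Finset.Icc 1 b, ((1 - ξ) ^ m)⁻¹ * bwdSum h m W (a + h)) =
      W a - ((1 - ξ) ^ b)⁻¹ * (bwdDiff h)^[b] W a := by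
  have hne : (1 - ξ) ≠ 0 := sub_ne_zero.2 hξ.symm
  induction b with
  | zero => simp
  | succ b ih =>
    rw [Finset.sum_Icc_succ_top (by omega), Finset.sum_Icc_succ_top (by omega), mul_add,
      add_sub_add_comm, ih, bwdSum_succ_eq_bwdDiff_iter, bwdSum_succ_eq_bwdDiff_iter,
      Function.iterate_succ_apply', add_sub_cancel_right]
    simp only [bwdDiff, pow_succ]
    field_simp
    ring

theorem fwdDiff_recurrence (h a : M) (ξ : ℂ) (u w : M → ℂ)
    (H : ∀ j : ℕ, u (a + j • h) - ξ * u (a + (j + 1) • h) = w (a + j • h)) (p j : ℕ) :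
    (fwdDiff h)^[p] u (a + j • h) - ξ * (fwdDiff h)^[p] u (a + (j + 1) • h) =
      (fwdDiff h)^[p] w (a + j • h) := by
  induction p generalizing j with
  | zero => simpa using H j
  | succ p ih =>
    simp only [Function.iterate_succ_apply', fwdDiff]
    have h1 := ih j
    have h2 := ih (j + 1)
    have e1 : a + j • h + h = a + (j + 1) • h := by rw [succ_nsmul]; abel
    have e2 : a + (j + 1) • h + h = a + (j + 1 + 1) • h := by rw [succ_nsmul _ (j + 1)]; abel
    rw [e1, e2]
    linear_combination h2 - h1

/-- Repeated summation by parts. -/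
theorem eq_sum_fwdDiff_of_recurrence (h a : M) (ξ : ℂ) (hξ : ξ ≠ 1) (u w : M → ℂ)
    (H : ∀ j : ℕ, u (a + j • h) - ξ * u (a + (j + 1) • h) = w (a + j • h)) (p : ℕ) :
    u a = ∑ q ∈ Finset.range p, ξ ^ q * ((1 - ξ) ^ (q + 1))⁻¹ * (fwdDiff h)^[q] w a +
      (ξ / (1 - ξ)) ^ p * (fwdDiff h)^[p] u a := by
  have hne : (1 - ξ) ≠ 0 := sub_ne_zero.2 hξ.symm
  induction p with
  | zero => simp
  | succ p ih =>
    rw [Finset.sum_range_succ]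
    have h1 := fwdDiff_recurrence h a ξ u w H p 0
    simp only [zero_smul, add_zero, zero_add, one_smul] at h1
    rw [ih, Function.iterate_succ_apply', ← h1]
    simp only [fwdDiff, div_pow, pow_succ]
    field_simp
    ring

namespace IsPolyMap

theorem zero (d : ℕ) : IsPolyMap d (0 : M → ℂ) := by
  induction d with
  | zero => rfl
  | succ d ih => intro h; convert ih; funext x; simp [fwdDiff]

theorem succ {d : ℕ} {g : M → ℂ} (hg : IsPolyMap d g) : IsPolyMap (d + 1) g := by
  induction d generalizing g with
  | zero => intro h; rw [show g = 0 from hg]; convert zero (M := M) 0; funext x; simp [fwdDiff]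
  | succ d ih => exact fun h => ih (hg h)

theorem mono {d e : ℕ} (hde : d ≤ e) {g : M → ℂ} (hg : IsPolyMap d g) : IsPolyMap e g := by
  induction hde with
  | refl => exact hg
  | step _ ih => exact ih.succ

theorem add {d : ℕ} {f g : M → ℂ} (hf : IsPolyMap d f) (hg : IsPolyMap d g) :
    IsPolyMap d (f + g) := by
  induction d generalizing f g with
  | zero => rw [show f = 0 from hf, show g = 0 from hg]; exact add_zero _
  | succ d ih => intro h; rw [fwdDiff_add]; exact ih (hf h) (hg h)

theorem const_mul {d : ℕ} (c : ℂ) {g : M → ℂ} (hg : IsPolyMap d g) :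
    IsPolyMap d (fun x => c * g x) := by
  induction d generalizing g with
  | zero => rw [show g = 0 from hg]; funext x; simp
  | succ d ih =>
    intro h
    convert ih (hg h) using 1
    funext x
    simp only [fwdDiff]
    ring

theorem shift {d : ℕ} (y : M) {g : M → ℂ} (hg : IsPolyMap d g) :
    IsPolyMap d (fun x => g (x + y)) := by
  induction d generalizing g with
  | zero => rw [show g = 0 from hg]; rfl
  | succ d ih =>
    intro h
    convert ih (hg h) using 1
    funext x
    simp only [fwdDiff, add_right_comm]

theorem shift_sub {d : ℕ} (y : M) {g : M → ℂ} (hg : IsPolyMap d g) :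
    IsPolyMap d (fun x => g (x - y)) := by
  simpa only [sub_eq_add_neg] using hg.shift (-y)

theorem sum {d : ℕ} {α : Type*} (s : Finset α) {g : α → M → ℂ} (hg : ∀ i, IsPolyMap d (g i)) :
    IsPolyMap d (fun x => ∑ i ∈ s, g i x) := by
  classical
  induction s using Finset.induction_on with
  | empty => simp only [Finset.sum_empty]; exact zero d
  | insert i s hi ih => simp only [Finset.sum_insert hi]; exact (hg i).add ih

theorem linear_mul {d : ℕ} (L : M →+ ℂ) {g : M → ℂ} (hg : IsPolyMap d g) :
    IsPolyMap (d + 1) (fun x => L x * g x) := by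
  induction d generalizing g with
  | zero => rw [show g = 0 from hg]; simp only [Pi.zero_apply, mul_zero]; exact zero 1
  | succ d ih =>
    intro h
    have e : fwdDiff h (fun x => L x * g x) =
        (fun x => L x * fwdDiff h g x) + fun x => L h * g (x + h) := by
      funext x
      simp only [fwdDiff, map_add, Pi.add_apply]
      ring
    rw [e]
    exact (ih (hg h)).add ((hg.shift h).const_mul _)

theorem linear_pow_mul {d : ℕ} (L : M →+ ℂ) (k : ℕ) {g : M → ℂ} (hg : IsPolyMap d g) :
    IsPolyMap (d + k) (fun x => L x ^ k * g x) := by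
  induction k with
  | zero => simpa using hg
  | succ k ih => simpa only [pow_succ', mul_assoc, ← add_assoc] using ih.linear_mul L

theorem prod_pow {ι : Type*} (s : Finset ι) (L : ι → M →+ ℂ) (k : ℕ) :
    IsPolyMap (s.card * k + 1) (fun x => ∏ i ∈ s, L i x ^ k) := by
  classical
  induction s using Finset.induction_on with
  | empty =>
    intro h
    simp only [Finset.prod_empty, fwdDiff_const]
    exact zero _
  | insert i s hi ih =>
    simp only [Finset.prod_insert hi, Finset.card_insert_of_notMem hi]
    convert ih.linear_pow_mul (L i) k using 1
    ring

theorem bwdDiff {d : ℕ} (h : M) {g : M → ℂ} (hg : IsPolyMap d g) :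
    IsPolyMap (d - 1) (bwdDiff h g) := by
  cases d with
  | zero => rw [show g = 0 from hg]; funext x; simp [_root_.bwdDiff]
  | succ d =>
    rw [Nat.add_sub_cancel]
    convert (hg h).shift_sub h using 1
    funext x
    simp [_root_.bwdDiff, fwdDiff]

theorem bwdDiff_iter {d : ℕ} (h : M) (q : ℕ) {g : M → ℂ} (hg : IsPolyMap d g) :
    IsPolyMap (d - q) ((_root_.bwdDiff h)^[q] g) := by
  induction q with
  | zero => exact hg
  | succ q ih => rw [Function.iterate_succ_apply']; exact ih.bwdDiff h

theorem fwdDiff_iter_eq_zero {d : ℕ} (h : M) {q : ℕ} (hq : d ≤ q) {g : M → ℂ}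
    (hg : IsPolyMap d g) : (fwdDiff h)^[q] g = 0 := by
  have key : ∀ q, ∀ g : M → ℂ, IsPolyMap q g → (fwdDiff h)^[q] g = 0 := by
    intro q
    induction q with
    | zero => exact fun g hg => hg
    | succ q ih => exact fun g hg => ih _ (hg h)
  exact key q g (hg.mono hq)

theorem bwdDiff_iter_eq_zero {d : ℕ} (h : M) {q : ℕ} (hq : d ≤ q) {g : M → ℂ}
    (hg : IsPolyMap d g) : (_root_.bwdDiff h)^[q] g = 0 := by
  have := hg.bwdDiff_iter h q
  rwa [Nat.sub_eq_zero_of_le hq] at this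

theorem bwdSum {d : ℕ} (h : M) (m : ℕ) {g : M → ℂ} (hg : IsPolyMap d g) :
    IsPolyMap (d - (m - 1)) (bwdSum h m g) := by
  cases m with
  | zero => convert zero (M := M) _; funext x; simp [_root_.bwdSum]
  | succ q =>
    rw [Nat.add_sub_cancel]
    convert (hg.bwdDiff_iter h q).shift_sub h using 1
    funext x
    exact bwdSum_succ_eq_bwdDiff_iter h q g x

end IsPolyMap

/-- The inner sum `∑ₗ {m; l} g (a - l • v)`. -/
def innerSum {r : ℕ} (v : Fin r → M) (g : M → ℂ) (m : Fin r → ℕ) (a : M) : ℂ :=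
  ∑ l ∈ Fintype.piFinset fun i => Finset.Icc 1 (m i),
    (∏ i, (-1 : ℂ) ^ (l i - 1) * ((m i - 1).choose (l i - 1) : ℂ)) * g (a - ∑ i, l i • v i)

/-- The special value, as a sum over the whole box `[1, b]^r`. -/
noncomputable def boxValue {r : ℕ} (ξ : Fin r → ℂ) (v : Fin r → M) (g : M → ℂ) (b : ℕ) (a : M) : ℂ :=
  ∑ m ∈ Fintype.piFinset fun _ : Fin r => Finset.Icc 1 b,
    (∏ i, (1 - ξ i) ^ m i)⁻¹ * innerSum v g m a

theorem innerSum_succ {r : ℕ} (v : Fin (r + 1) → M) (g : M → ℂ) (m : Fin (r + 1) → ℕ) :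
    innerSum v g m = bwdSum (v 0) (m 0) (innerSum (fun i => v i.succ) g (fun i => m i.succ)) := by
  funext a
  rw [innerSum, sum_piFinset_succ, bwdSum]
  refine Finset.sum_congr rfl fun l _ => ?_
  rw [innerSum, Finset.mul_sum]
  refine Finset.sum_congr rfl fun l' _ => ?_
  simp only [Fin.prod_univ_succ, Fin.sum_univ_succ, Fin.cons_zero, Fin.cons_succ, sub_sub]
  ring

theorem bwdSum_sum {α : Type*} (s : Finset α) (c : α → ℂ) (h : M) (m : ℕ) (g : α → M → ℂ)
    (a : M) :
    bwdSum h m (fun x => ∑ i ∈ s, c i * g i x) a = ∑ i ∈ s, c i * bwdSum h m (g i) a := by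
  simp only [bwdSum, Finset.mul_sum]
  rw [Finset.sum_comm]
  exact Finset.sum_congr rfl fun i _ => Finset.sum_congr rfl fun l _ => by ring

theorem boxValue_succ {r : ℕ} (ξ : Fin (r + 1) → ℂ) (v : Fin (r + 1) → M) (g : M → ℂ) (b : ℕ)
    (a : M) :
    boxValue ξ v g b a = ∑ m ∈ Finset.Icc 1 b, ((1 - ξ 0) ^ m)⁻¹ *
      bwdSum (v 0) m (boxValue (fun i => ξ i.succ) (fun i => v i.succ) g b) a := by
  rw [boxValue, sum_piFinset_succ]
  refine Finset.sum_congr rfl fun m _ => ?_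
  unfold boxValue
  rw [bwdSum_sum, Finset.mul_sum]
  refine Finset.sum_congr rfl fun m' _ => ?_
  simp only [innerSum_succ, Fin.prod_univ_succ, Fin.cons_zero, Fin.cons_succ, mul_inv]
  ring

theorem IsPolyMap.innerSum {d r : ℕ} (v : Fin r → M) (m : Fin r → ℕ) {g : M → ℂ}
    (hg : IsPolyMap d g) : IsPolyMap (d - ∑ i, (m i - 1)) (innerSum v g m) := by
  induction r with
  | zero =>
    have : _root_.innerSum v g m = g := by funext a; simp [_root_.innerSum]
    simpa [this] using hg
  | succ r ih =>
    rw [innerSum_succ, Fin.sum_univ_succ, add_comm, ← Nat.sub_sub]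
    exact (ih (fun i => v i.succ) (fun i => m i.succ)).bwdSum _ _

theorem IsPolyMap.boxValue {d r : ℕ} (ξ : Fin r → ℂ) (v : Fin r → M) (b : ℕ) {g : M → ℂ}
    (hg : IsPolyMap d g) : IsPolyMap d (boxValue ξ v g b) :=
  IsPolyMap.sum _ fun m => ((hg.innerSum v m).mono (Nat.sub_le _ _)).const_mul _

theorem innerSum_eq_zero {d r : ℕ} (v : Fin r → M) (m : Fin r → ℕ) {g : M → ℂ}
    (hg : IsPolyMap d g) (hm : ∀ i, 1 ≤ m i) (hd : d + r ≤ ∑ i, m i) : innerSum v g m = 0 := by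
  have h1 := hg.innerSum v m
  have h2 : ∑ i, (m i - 1) + r = ∑ i, m i := by
    have : ∑ i, m i = ∑ i, ((m i - 1) + 1) :=
      Finset.sum_congr rfl fun i _ => by have := hm i; omega
    rw [this, Finset.sum_add_distrib]
    simp
  rwa [Nat.sub_eq_zero_of_le (by omega)] at h1

theorem boxValue_sub {d r : ℕ} (ξ : Fin (r + 1) → ℂ) (hξ : ξ 0 ≠ 1) (v : Fin (r + 1) → M)
    {g : M → ℂ} (hg : IsPolyMap d g) {b : ℕ} (hb : d ≤ b) (a : M) :
    boxValue ξ v g b a - ξ 0 * boxValue ξ v g b (a + v 0) =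
      boxValue (fun i => ξ i.succ) (fun i => v i.succ) g b a := by
  rw [boxValue_succ, boxValue_succ, sum_pow_mul_bwdSum_sub _ _ _ hξ,
    (hg.boxValue _ _ b).bwdDiff_iter_eq_zero _ hb]
  simp

end Algebraic

section Analytic

/-- Cauchy estimate for iterated differences of a function holomorphic near `[0, p]`. -/
theorem norm_fwdDiff_iter_le (p : ℕ) (R ρ B : ℝ) (Φ : ℂ → ℂ) (hρ : 0 < ρ) (hR : p * ρ < R)
    (hΦ : ∀ w : ℂ, (∃ t : ℝ, 0 ≤ t ∧ t ≤ p ∧ ‖w - t‖ < R) → DifferentiableAt ℂ Φ w ∧ ‖Φ w‖ ≤ B) :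
    ‖(fwdDiff 1)^[p] Φ 0‖ ≤ B / ρ ^ p := by
  induction p generalizing R B Φ with
  | zero =>
    simp only [CharP.cast_eq_zero, zero_mul] at hR
    simpa using (hΦ 0 ⟨0, le_rfl, by simp, by simpa using hR⟩).2
  | succ p ih =>
    rw [Function.iterate_succ_apply, pow_succ', ← div_div]
    push_cast at hR hΦ
    refine ih (R - ρ) (B / ρ) (fwdDiff 1 Φ) (by linarith) ?_
    rintro w ⟨t, ht0, htp, hw⟩
    have hseg : ∀ θ : ℝ, 0 ≤ θ → θ ≤ 1 → ∀ y : ℂ, ‖y - (w + θ)‖ ≤ ρ →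
        DifferentiableAt ℂ Φ y ∧ ‖Φ y‖ ≤ B := by
      intro θ h0 h1 y hy
      refine hΦ y ⟨t + θ, by linarith, by linarith, ?_⟩
      calc ‖y - ((t + θ : ℝ) : ℂ)‖ = ‖(y - (w + θ)) + (w - t)‖ := by push_cast; ring_nf
        _ ≤ ‖y - (w + θ)‖ + ‖w - t‖ := norm_add_le _ _
        _ < R := by linarith
    have hder : ∀ x ∈ segment ℝ w (w + 1), DifferentiableAt ℂ Φ x ∧ ‖deriv Φ x‖ ≤ B / ρ := by
      intro x hx
      rw [segment_eq_image'] at hx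
      obtain ⟨θ, ⟨h0, h1⟩, rfl⟩ := hx
      have e : w + θ • (w + 1 - w) = w + (θ : ℂ) := by simp
      simp only [e]
      refine ⟨(hseg θ h0 h1 _ (by simpa using hρ.le)).1,
        Complex.norm_deriv_le_of_forall_mem_sphere_norm_le hρ ?_ ?_⟩
      · refine DifferentiableOn.diffContOnCl fun y hy => ?_
        rw [closure_ball _ hρ.ne', mem_closedBall_iff_norm] at hy
        exact (hseg θ h0 h1 y hy).1.differentiableWithinAt
      · intro y hy
        rw [mem_sphere_iff_norm] at hy
        exact (hseg θ h0 h1 y hy.le).2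
    constructor
    · have h1 : DifferentiableAt ℂ Φ (w + 1) := (hder _ (right_mem_segment ℝ _ _)).1
      have h2 : DifferentiableAt ℂ Φ w := (hder _ (left_mem_segment ℝ _ _)).1
      exact (differentiableAt_comp_add_const.2 h1).sub h2
    · have := (convex_segment w (w + 1)).norm_image_sub_le_of_norm_deriv_le
        (fun x hx => (hder x hx).1) (fun x hx => (hder x hx).2)
        (left_mem_segment ℝ _ _) (right_mem_segment ℝ _ _)
      simpa [fwdDiff] using this

theorem summable_prod_pi (f : ℕ → ℝ) (hf0 : ∀ n, 0 ≤ f n) (hf : Summable f) (r : ℕ) :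
    Summable fun m : Fin r → ℕ => ∏ i, f (m i) := by
  induction r with
  | zero => exact Summable.of_finite
  | succ r ih =>
    rw [← (Fin.consEquiv fun _ : Fin (r + 1) => ℕ).summable_iff]
    convert hf.mul_of_nonneg ih hf0 fun m => Finset.prod_nonneg fun i _ => hf0 _ using 1
    funext x
    simp [Fin.consEquiv, Fin.prod_univ_succ]

theorem summable_inv_one_add_sum_pow (r : ℕ) :
    Summable fun m : Fin r → ℕ => ((1 + ∑ i, (m i : ℝ)) ^ (2 * r))⁻¹ := by
  have h2 : Summable fun n : ℕ => ((1 + (n : ℝ)) ^ 2)⁻¹ := by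
    have := (summable_nat_add_iff 1).2 (Real.summable_nat_pow_inv (p := 2).2 one_lt_two)
    refine this.congr fun n => ?_
    push_cast
    rw [add_comm]
  refine Summable.of_nonneg_of_le (fun m => by positivity) (fun m => ?_)
    (summable_prod_pi _ (fun n => by positivity) h2 r)
  rw [Finset.prod_inv_distrib]
  refine inv_anti₀ (Finset.prod_pos fun i _ => by positivity) ?_
  calc ∏ i, (1 + (m i : ℝ)) ^ 2 ≤ ∏ _i : Fin r, (1 + ∑ j, (m j : ℝ)) ^ 2 := by
        refine Finset.prod_le_prod (fun i _ => by positivity) fun i hi => ?_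
        have := Finset.single_le_sum (f := fun j => (m j : ℝ)) (fun j _ => by positivity) hi
        gcongr
    _ = _ := by rw [Finset.prod_const, Finset.card_univ, Fintype.card_fin, ← pow_mul]

variable {M : Type*} [AddCommGroup M] {ι : Type*} [Fintype ι] (ℓ : ι → M →+ ℝ)

/-- The summand `(∏ᵢ ℓᵢ a) ^ (-s)`. -/
noncomputable def normTerm (s : ℂ) (a : M) : ℂ :=
  Complex.exp (-s * ((∑ i, Real.log (ℓ i a) : ℝ) : ℂ))

theorem differentiable_normTerm (a : M) : Differentiable ℂ fun s => normTerm ℓ s a := by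
  unfold normTerm
  fun_prop

/-- Linear forms are comparable to the height on a finitely generated positive cone. -/
theorem exists_linear_bounds {r : ℕ} (a : M) (ha : ∀ i, 0 < ℓ i a) (v : Fin r → M)
    (hv : ∀ j i, 0 < ℓ i (v j)) :
    ∃ C : ℝ, 1 ≤ C ∧ ∀ (m : Fin r → ℕ) i,
      (1 + ∑ j, (m j : ℝ)) / C ≤ ℓ i (a + ∑ j, m j • v j) ∧
        ℓ i (a + ∑ j, m j • v j) ≤ C * (1 + ∑ j, (m j : ℝ)) := by
  set C : ℝ := 1 + ∑ i, ((ℓ i a + (ℓ i a)⁻¹) + ∑ j, (ℓ i (v j) + (ℓ i (v j))⁻¹)) with hC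
  have hp : ∀ x : ℝ, 0 < x → 0 ≤ x + x⁻¹ := fun x hx => by positivity
  have hs : ∀ i, 0 ≤ ∑ j, (ℓ i (v j) + (ℓ i (v j))⁻¹) := fun i =>
    Finset.sum_nonneg fun j _ => hp _ (hv j i)
  have hC1 : 1 ≤ C := by
    have : 0 ≤ ∑ i, ((ℓ i a + (ℓ i a)⁻¹) + ∑ j, (ℓ i (v j) + (ℓ i (v j))⁻¹)) :=
      Finset.sum_nonneg fun i _ => add_nonneg (hp _ (ha i)) (hs i)
    linarith
  have hi : ∀ i, (ℓ i a + (ℓ i a)⁻¹) + ∑ j, (ℓ i (v j) + (ℓ i (v j))⁻¹) ≤ C := by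
    intro i
    have := Finset.single_le_sum
      (f := fun i => (ℓ i a + (ℓ i a)⁻¹) + ∑ j, (ℓ i (v j) + (ℓ i (v j))⁻¹))
      (fun i _ => add_nonneg (hp _ (ha i)) (hs i)) (Finset.mem_univ i)
    linarith
  have hbd : ∀ x : ℝ, 0 < x → x + x⁻¹ ≤ C → 1 / C ≤ x ∧ x ≤ C := by
    intro x hx hxC
    have hxi : 0 < x⁻¹ := inv_pos.2 hx
    refine ⟨?_, by linarith⟩
    rw [one_div]
    exact inv_le_of_inv_le₀ hx (by linarith)
  have hba : ∀ i, 1 / C ≤ ℓ i a ∧ ℓ i a ≤ C := fun i =>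
    hbd _ (ha i) (by linarith [hi i, hs i])
  have hbv : ∀ j i, 1 / C ≤ ℓ i (v j) ∧ ℓ i (v j) ≤ C := fun j i => by
    refine hbd _ (hv j i) ?_
    have := Finset.single_le_sum (f := fun j => ℓ i (v j) + (ℓ i (v j))⁻¹)
      (fun j _ => hp _ (hv j i)) (Finset.mem_univ j)
    linarith [hi i, hp _ (ha i)]
  refine ⟨C, hC1, fun m i => ?_⟩
  have e : ℓ i (a + ∑ j, m j • v j) = ℓ i a + ∑ j, (m j : ℝ) * ℓ i (v j) := by
    simp [map_add, map_sum, map_nsmul]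
  rw [e]
  constructor
  · rw [add_div, Finset.sum_div]
    refine add_le_add (hba i).1 (Finset.sum_le_sum fun j _ => ?_)
    rw [div_eq_mul_one_div]
    exact mul_le_mul_of_nonneg_left (hbv j i).1 (by positivity)
  · rw [mul_add, mul_one, Finset.mul_sum]
    refine add_le_add (hba i).2 (Finset.sum_le_sum fun j _ => ?_)
    rw [mul_comm]
    exact mul_le_mul_of_nonneg_right (hbv j i).2 (by positivity)

theorem norm_log_le (Q : ℝ) (L : ℂ) (hL : L ≠ 0) (h1 : ‖L‖ ≤ Q) (h2 : ‖L‖⁻¹ ≤ Q) :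
    ‖Complex.log L‖ ≤ Real.log Q + Real.pi := by
  have hpos : 0 < ‖L‖ := norm_pos_iff.2 hL
  refine (Complex.norm_le_abs_re_add_abs_im _).trans (add_le_add ?_ ?_)
  · rw [Complex.log_re, abs_le]
    have h3 := Real.log_le_log hpos h1
    have h4 := Real.log_le_log (inv_pos.2 hpos) h2
    rw [Real.log_inv] at h4
    exact ⟨by linarith, h3⟩
  · rw [Complex.log_im]
    exact Complex.abs_arg_le_pi L

/-- High order differences of the summand decay polynomially along a cone, locally uniformly
in `s`. -/
theorem exists_norm_fwdDiff_normTerm_le {r : ℕ} (a : M) (ha : ∀ i, 0 < ℓ i a) (v : Fin r → M)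
    (hv : ∀ j i, 0 < ℓ i (v j)) (h : M) (hh : ∀ i, 0 < ℓ i h) (K p : ℕ) :
    ∃ B : ℝ, ∀ s : ℂ, ‖s‖ ≤ K → ∀ m : Fin r → ℕ,
      ‖(fwdDiff h)^[p] (normTerm ℓ s) (a + ∑ j, m j • v j)‖ ≤
        B * (1 + ∑ j, (m j : ℝ)) ^ (K * Fintype.card ι) / (1 + ∑ j, (m j : ℝ)) ^ p := by
  obtain ⟨C, hC1, hC⟩ := exists_linear_bounds ℓ a ha (Fin.cons h v)
    (fun j i => by refine Fin.cases ?_ (fun j => ?_) j <;> simp [hh, hv])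
  have hCh : ∀ i, ℓ i h ≤ 2 * C := by
    intro i
    have := (hC (Fin.cons 1 fun _ => 0) i).2
    simp [Fin.sum_univ_succ] at this
    linarith [ha i]
  have hC' : ∀ (m : Fin r → ℕ) i, (1 + ∑ j, (m j : ℝ)) / C ≤ ℓ i (a + ∑ j, m j • v j) ∧
        ℓ i (a + ∑ j, m j • v j) ≤ C * (1 + ∑ j, (m j : ℝ)) := by
    intro m i
    simpa [Fin.sum_univ_succ] using hC (Fin.cons 0 m) i
  have hC0 : 0 < C := by linarith
  set Q : ℝ := (2 * p + 2) * C with hQ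
  set E : ℝ := Real.exp Real.pi with hE
  refine ⟨(Q * E) ^ (K * Fintype.card ι) * (4 * C ^ 2 * (p + 1)) ^ p, fun s hs m => ?_⟩
  set T : ℝ := 1 + ∑ j, (m j : ℝ) with hT
  set b := a + ∑ j, m j • v j with hb
  have hT1 : 1 ≤ T := by
    have : 0 ≤ ∑ j, (m j : ℝ) := Finset.sum_nonneg fun j _ => by positivity
    linarith
  have hT0 : 0 < T := by linarith
  have hQ1 : 1 ≤ Q := by
    have : 0 ≤ (p : ℝ) := by positivity
    nlinarith
  have hQT : 1 ≤ Q * T := by nlinarith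
  set Φ : ℂ → ℂ := fun w => Complex.exp (-s * ∑ i, Complex.log (ℓ i b + w * ℓ i h)) with hΦ
  have e : (fwdDiff h)^[p] (normTerm ℓ s) b = (fwdDiff 1)^[p] Φ 0 := by
    rw [fwdDiff_iter_eq_sum_shift, fwdDiff_iter_eq_sum_shift]
    refine Finset.sum_congr rfl fun j _ => ?_
    congr 1
    simp only [hΦ, normTerm]
    push_cast
    congr 3
    funext i
    have hpos : 0 ≤ ℓ i b + j * ℓ i h := by
      have h1 := (hC' m i).1
      have h2 : 0 < T / C := by positivity
      have h3 := hh i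
      have : 0 ≤ (j : ℝ) * ℓ i h := by positivity
      linarith
    rw [map_add, map_nsmul, nsmul_eq_mul, Complex.ofReal_log hpos]
    congr 1
    simp
  have key : ∀ w : ℂ, (∃ t : ℝ, 0 ≤ t ∧ t ≤ p ∧ ‖w - t‖ < T / (4 * C ^ 2)) → ∀ i,
      0 < (ℓ i b + w * ℓ i h : ℂ).re ∧ ‖Complex.log (ℓ i b + w * ℓ i h)‖ ≤
        Real.log (Q * T) + Real.pi := by
    rintro w ⟨t, ht0, htp, hw⟩ i
    have h1 := (hC' m i).1
    have h2 := (hC' m i).2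
    have h3 := hh i
    have h4 := hCh i
    have hsplit : (ℓ i b + w * ℓ i h : ℂ) = ((ℓ i b + t * ℓ i h : ℝ) : ℂ) + (w - t) * ℓ i h := by
      push_cast; ring
    have herr : ‖(w - t) * (ℓ i h : ℂ)‖ ≤ T / (2 * C) := by
      rw [norm_mul, Complex.norm_real, Real.norm_of_nonneg h3.le]
      calc ‖w - t‖ * ℓ i h ≤ T / (4 * C ^ 2) * (2 * C) := by gcongr
        _ = T / (2 * C) := by field_simp; ring
    have hth : 0 ≤ t * ℓ i h := by positivity
    have hTC : T / C = T / (2 * C) + T / (2 * C) := by field_simp; ring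
    have hre : T / (2 * C) ≤ (ℓ i b + w * ℓ i h : ℂ).re := by
      rw [hsplit, Complex.add_re, Complex.ofReal_re]
      have := (abs_le.1 ((Complex.abs_re_le_norm _).trans herr)).1
      linarith
    have hre0 : 0 < (ℓ i b + w * ℓ i h : ℂ).re := lt_of_lt_of_le (by positivity) hre
    refine ⟨hre0, norm_log_le _ _ (fun h0 => by rw [h0] at hre0; simp at hre0) ?_ ?_⟩
    · have hT2 : T / (2 * C) ≤ C * T := by
        rw [div_le_iff₀ (by positivity)]
        nlinarith [mul_pos hC0 hT0, mul_le_mul hC1 hC1 zero_le_one hC0.le]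
      have h5 : t * ℓ i h ≤ p * (2 * C) * T := by
        calc t * ℓ i h ≤ p * (2 * C) := by gcongr
          _ ≤ p * (2 * C) * T := le_mul_of_one_le_right (by positivity) hT1
      calc ‖(ℓ i b + w * ℓ i h : ℂ)‖ ≤ ‖((ℓ i b + t * ℓ i h : ℝ) : ℂ)‖ + ‖(w - t) * (ℓ i h : ℂ)‖ := by
            rw [hsplit]; exact norm_add_le _ _
        _ ≤ (C * T + p * (2 * C) * T) + C * T := by
            rw [Complex.norm_real, Real.norm_of_nonneg]
            · linarith
            · have : 0 < T / C := by positivity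
              linarith
        _ = Q * T := by rw [hQ]; ring
    · have h5 : T / (2 * C) ≤ ‖(ℓ i b + w * ℓ i h : ℂ)‖ := hre.trans (Complex.re_le_norm _)
      calc ‖(ℓ i b + w * ℓ i h : ℂ)‖⁻¹ ≤ (T / (2 * C))⁻¹ := inv_anti₀ (by positivity) h5
        _ = 2 * C / T := by rw [inv_div]
        _ ≤ 2 * C * T := by
            rw [div_le_iff₀ hT0]
            have : 1 ≤ T * T := by nlinarith
            nlinarith
        _ ≤ Q * T := by
            rw [hQ]
            gcongr
            have : 0 ≤ (p : ℝ) := by positivity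
            linarith
  have hmain := norm_fwdDiff_iter_le p (T / (4 * C ^ 2)) (T / (4 * C ^ 2 * (p + 1)))
    ((Q * T * E) ^ (K * Fintype.card ι)) Φ (by positivity) (by
      rw [← div_div, mul_div_assoc', div_lt_iff₀ (by positivity), mul_comm]
      gcongr
      linarith) (fun w hw => by
      constructor
      · have hd : ∀ i, DifferentiableAt ℂ (fun w : ℂ => Complex.log (ℓ i b + w * ℓ i h)) w :=
          fun i => DifferentiableAt.clog (by fun_prop) (Or.inl (key w hw i).1)
        have : DifferentiableAt ℂ (fun w : ℂ => ∑ i, Complex.log (ℓ i b + w * ℓ i h)) w :=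
          DifferentiableAt.fun_sum fun i _ => hd i
        exact (this.const_mul (-s)).cexp
      · rw [hΦ, Complex.norm_exp]
        have h1 : ‖-s * ∑ i, Complex.log (ℓ i b + w * ℓ i h)‖ ≤
            K * (Fintype.card ι * (Real.log (Q * T) + Real.pi)) := by
          rw [norm_mul, norm_neg]
          refine mul_le_mul hs ?_ (norm_nonneg _) (by positivity)
          refine (norm_sum_le _ _).trans ?_
          refine (Finset.sum_le_sum fun i _ => (key w hw i).2).trans (le_of_eq ?_)
          rw [Finset.sum_const, Finset.card_univ, nsmul_eq_mul]
        refine (Real.exp_le_exp.2 ((Complex.re_le_norm _).trans h1)).trans (le_of_eq ?_)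
        rw [← mul_assoc, ← Nat.cast_mul, Real.exp_nat_mul, Real.exp_add,
          Real.exp_log (by linarith)])
  rw [e]
  refine hmain.trans (le_of_eq ?_)
  rw [mul_right_comm Q T E, mul_pow (Q * E), div_pow]
  field_simp

end Analytic

section Continuation

variable {M : Type*} [AddCommGroup M] {ι : Type*} (ℓ : ι → M →+ ℝ)

theorem pos_add_nsmul (a h : M) (ha : ∀ i, 0 < ℓ i a) (hh : ∀ i, 0 < ℓ i h) (j : ℕ) (i : ι) :
    0 < ℓ i (a + j • h) := by
  rw [map_add, map_nsmul]
  exact add_pos_of_pos_of_nonneg (ha i) (nsmul_nonneg (hh i).le j)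

theorem pos_add_sum_nsmul {r : ℕ} (a : M) (v : Fin r → M) (ha : ∀ i, 0 < ℓ i a)
    (hv : ∀ j i, 0 < ℓ i (v j)) (m : Fin r → ℕ) (i : ι) : 0 < ℓ i (a + ∑ j, m j • v j) := by
  rw [map_add, map_sum]
  refine add_pos_of_pos_of_nonneg (ha i) (Finset.sum_nonneg fun j _ => ?_)
  rw [map_nsmul]
  exact nsmul_nonneg (hv j i).le _

variable [Fintype ι]

/-- The twisted Dirichlet series attached to a product of linear forms. -/
noncomputable def twistedSeries {r : ℕ} (ξ : Fin r → ℂ) (v : Fin r → M) (s : ℂ) (a : M) : ℂ :=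
  ∑' m : Fin r → ℕ, (∏ j, ξ j ^ m j) * normTerm ℓ s (a + ∑ j, m j • v j)

theorem norm_prod_pow_le_one {r : ℕ} (ξ : Fin r → ℂ) (hξ : ∀ j, ‖ξ j‖ ≤ 1) (m : Fin r → ℕ) :
    ‖∏ j, ξ j ^ m j‖ ≤ 1 := by
  rw [norm_prod]
  refine Finset.prod_le_one (fun j _ => norm_nonneg _) fun j _ => ?_
  rw [norm_pow]
  exact pow_le_one₀ (norm_nonneg _) (hξ j)

theorem summable_twistedSeries [Nonempty ι] {r : ℕ} (ξ : Fin r → ℂ) (hξ : ∀ j, ‖ξ j‖ ≤ 1)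
    (v : Fin r → M) (hv : ∀ j i, 0 < ℓ i (v j)) (s : ℂ) (hs : 2 * r < s.re) (a : M)
    (ha : ∀ i, 0 < ℓ i a) :
    Summable fun m : Fin r → ℕ => (∏ j, ξ j ^ m j) * normTerm ℓ s (a + ∑ j, m j • v j) := by
  obtain ⟨C, hC1, hC⟩ := exists_linear_bounds ℓ a ha v hv
  refine Summable.of_norm_bounded
    ((summable_inv_one_add_sum_pow r).mul_left (Real.exp (s.re * Fintype.card ι * Real.log C)))
    fun m => ?_
  rw [norm_mul]
  refine (mul_le_of_le_one_left (norm_nonneg _) (norm_prod_pow_le_one ξ hξ m)).trans ?_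
  set T : ℝ := 1 + ∑ j, (m j : ℝ) with hT
  have hT1 : 1 ≤ T := by
    have : 0 ≤ ∑ j, (m j : ℝ) := Finset.sum_nonneg fun j _ => by positivity
    linarith
  have hT0 : 0 < T := by linarith
  have hC0 : 0 < C := by linarith
  have hs0 : 0 < s.re := lt_of_le_of_lt (by positivity) hs
  have hlog : (Fintype.card ι : ℝ) * (Real.log T - Real.log C) ≤
      ∑ i, Real.log (ℓ i (a + ∑ j, m j • v j)) := by
    rw [← Real.log_div hT0.ne' hC0.ne', ← nsmul_eq_mul, ← Finset.card_univ, ← Finset.sum_const]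
    exact Finset.sum_le_sum fun i _ => Real.log_le_log (by positivity) (hC m i).1
  have hn : (1 : ℝ) ≤ Fintype.card ι := by exact_mod_cast Fintype.card_pos
  have hlT : 0 ≤ Real.log T := Real.log_nonneg hT1
  have e : (T ^ (2 * r))⁻¹ = Real.exp (-(2 * r * Real.log T)) := by
    rw [Real.exp_neg, ← Real.exp_log hT0, ← Real.exp_nat_mul, Real.log_exp]
    push_cast
    rfl
  rw [normTerm, Complex.norm_exp, e, ← Real.exp_add, Real.exp_le_exp,
    Complex.re_mul_ofReal, Complex.neg_re]
  have h1 := mul_le_mul_of_nonneg_left hlog hs0.le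
  have h2 : 2 * (r : ℝ) ≤ s.re * Fintype.card ι := hs.le.trans (le_mul_of_one_le_right hs0.le hn)
  have h3 := mul_le_mul_of_nonneg_right h2 hlT
  linarith

theorem twistedSeries_sub [Nonempty ι] {r : ℕ} (ξ : Fin (r + 1) → ℂ) (hξ : ∀ j, ‖ξ j‖ ≤ 1)
    (v : Fin (r + 1) → M) (hv : ∀ j i, 0 < ℓ i (v j)) (s : ℂ) (hs : 2 * ((r + 1 : ℕ) : ℝ) < s.re)
    (a : M) (ha : ∀ i, 0 < ℓ i a) :
    twistedSeries ℓ ξ v s a - ξ 0 * twistedSeries ℓ ξ v s (a + v 0) =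
      twistedSeries ℓ (fun j => ξ j.succ) (fun j => v j.succ) s a := by
  have split : ∀ a, (∀ i, 0 < ℓ i a) → Summable (fun x : ℕ × (Fin r → ℕ) =>
      ξ 0 ^ x.1 * ((∏ j, ξ j.succ ^ x.2 j) *
        normTerm ℓ s (a + x.1 • v 0 + ∑ j, x.2 j • v j.succ))) ∧
      twistedSeries ℓ ξ v s a = ∑' n : ℕ, ξ 0 ^ n *
        twistedSeries ℓ (fun j => ξ j.succ) (fun j => v j.succ) s (a + n • v 0) := by
    intro a ha
    have h1 := summable_twistedSeries ℓ ξ hξ v hv s hs a ha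
    have h2 := ((Fin.consEquiv fun _ : Fin (r + 1) => ℕ).summable_iff).2 h1
    have e : ((fun m : Fin (r + 1) → ℕ =>
        (∏ j, ξ j ^ m j) * normTerm ℓ s (a + ∑ j, m j • v j)) ∘
        (Fin.consEquiv fun _ : Fin (r + 1) => ℕ)) = fun x : ℕ × (Fin r → ℕ) =>
      ξ 0 ^ x.1 * ((∏ j, ξ j.succ ^ x.2 j) *
        normTerm ℓ s (a + x.1 • v 0 + ∑ j, x.2 j • v j.succ)) := by
      funext x
      simp [Fin.consEquiv, Fin.prod_univ_succ, Fin.sum_univ_succ, mul_assoc, add_assoc]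
    rw [e] at h2
    refine ⟨h2, ?_⟩
    rw [twistedSeries, ← (Fin.consEquiv fun _ : Fin (r + 1) => ℕ).tsum_eq]
    refine (congrArg tsum e).trans ?_
    rw [h2.tsum_prod]
    refine tsum_congr fun n => ?_
    rw [twistedSeries, ← tsum_mul_left]
  have ha' : ∀ i, 0 < ℓ i (a + v 0) := fun i => by
    rw [map_add]; exact add_pos (ha i) (hv 0 i)
  rw [(split a ha).2, (split _ ha').2]
  have hF : Summable fun n : ℕ => ξ 0 ^ n *
        twistedSeries ℓ (fun j => ξ j.succ) (fun j => v j.succ) s (a + n • v 0) := by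
    refine (split a ha).1.prod.congr fun n => ?_
    rw [twistedSeries, ← tsum_mul_left]
  rw [hF.tsum_eq_zero_add, ← tsum_mul_left]
  have : ∀ n : ℕ, a + v 0 + n • v 0 = a + (n + 1) • v 0 := fun n => by
    rw [succ_nsmul]; abel
  simp only [this, pow_succ', mul_assoc]
  simp

theorem normTerm_neg_natCast (k : ℕ) (a : M) (ha : ∀ i, 0 < ℓ i a) :
    normTerm ℓ (-k) a = ∏ i, (ℓ i a : ℂ) ^ k := by
  rw [normTerm, neg_neg, Complex.exp_nat_mul, ← Complex.ofReal_exp, Real.exp_sum,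
    Complex.ofReal_prod, Finset.prod_pow]
  simp only [Real.exp_log (ha _)]

theorem fwdDiff_iter_congr (h a : M) (u w : M → ℂ) (p : ℕ)
    (H : ∀ j : ℕ, u (a + j • h) = w (a + j • h)) : (fwdDiff h)^[p] u a = (fwdDiff h)^[p] w a := by
  simp only [fwdDiff_iter_eq_sum_shift, H]

/-- Continuation of the twisted series to arbitrarily large discs, with its value at `-k`. -/
theorem exists_continuation [Nonempty ι] (K k b : ℕ) (hk : k < K) (hb : Fintype.card ι * k + 1 ≤ b)
    {r : ℕ} (ξ : Fin r → ℂ) (hξ : ∀ j, ‖ξ j‖ ≤ 1) (hξ1 : ∀ j, ξ j ≠ 1)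
    (v : Fin r → M) (hv : ∀ j i, 0 < ℓ i (v j)) :
    ∃ H : ℂ → M → ℂ, ∀ a : M, (∀ i, 0 < ℓ i a) →
      DifferentiableOn ℂ (fun s => H s a) (Metric.ball 0 K) ∧
      (∀ s : ℂ, 2 * r < s.re → H s a = twistedSeries ℓ ξ v s a) ∧
      H (-k) a = boxValue ξ v (fun x => ∏ i, (ℓ i x : ℂ) ^ k) b a := by
  have hpoly : IsPolyMap (Fintype.card ι * k + 1) (fun x : M => ∏ i, (ℓ i x : ℂ) ^ k) :=
    IsPolyMap.prod_pow Finset.univ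
      (fun i => (Complex.ofRealHom : ℝ →+* ℂ).toAddMonoidHom.comp (ℓ i)) k
  induction r with
  | zero =>
    refine ⟨normTerm ℓ, fun a ha => ⟨(differentiable_normTerm ℓ a).differentiableOn, ?_, ?_⟩⟩
    · intro s _
      simp [twistedSeries]
    · rw [normTerm_neg_natCast ℓ k a ha]
      simp [boxValue, innerSum]
  | succ r ih =>
    obtain ⟨H, hH⟩ := ih (fun j => ξ j.succ) (fun j => hξ _) (fun j => hξ1 _) (fun j => v j.succ)
      (fun j => hv _)
    set p : ℕ := K * Fintype.card ι + 2 * (r + 1) with hp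
    have hpb : Fintype.card ι * k + 1 ≤ p := by nlinarith [Fintype.card_pos (α := ι)]
    have hsum : ∀ a : M, (∀ i, 0 < ℓ i a) → ∃ u : (Fin (r + 1) → ℕ) → ℝ, Summable u ∧
        ∀ m, ∀ s ∈ Metric.ball (0 : ℂ) K, ‖(∏ j, ξ j ^ m j) *
          (fwdDiff (v 0))^[p] (normTerm ℓ s) (a + ∑ j, m j • v j)‖ ≤ u m := by
      intro a ha
      obtain ⟨B, hB⟩ := exists_norm_fwdDiff_normTerm_le ℓ a ha v hv (v 0) (hv 0) K p
      refine ⟨_, (summable_inv_one_add_sum_pow (r + 1)).mul_left B, fun m s hs => ?_⟩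
      rw [norm_mul]
      refine (mul_le_of_le_one_left (norm_nonneg _) (norm_prod_pow_le_one ξ hξ m)).trans ?_
      refine (hB s (by simpa using (mem_ball_zero_iff.1 hs).le) m).trans (le_of_eq ?_)
      have : 0 < 1 + ∑ j, (m j : ℝ) :=
        add_pos_of_pos_of_nonneg one_pos (Finset.sum_nonneg fun j _ => by positivity)
      rw [hp, pow_add]
      field_simp
    refine ⟨fun s a => ∑ q ∈ Finset.range p, ξ 0 ^ q * ((1 - ξ 0) ^ (q + 1))⁻¹ *
      (fwdDiff (v 0))^[q] (H s) a + (ξ 0 / (1 - ξ 0)) ^ p * ∑' m : Fin (r + 1) → ℕ,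
        (∏ j, ξ j ^ m j) * (fwdDiff (v 0))^[p] (normTerm ℓ s) (a + ∑ j, m j • v j),
      fun a ha => ⟨?_, ?_, ?_⟩⟩
    · obtain ⟨u, hu, hub⟩ := hsum a ha
      refine DifferentiableOn.fun_add (DifferentiableOn.fun_sum fun q _ => ?_) ?_
      · refine DifferentiableOn.const_mul ?_ _
        simp only [fwdDiff_iter_eq_sum_shift]
        refine DifferentiableOn.fun_sum fun j _ => ?_
        exact (hH _ (pos_add_nsmul ℓ a (v 0) ha (hv 0) j)).1.const_smul _
      · refine DifferentiableOn.const_mul ?_ _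
        refine Complex.differentiableOn_tsum_of_summable_norm hu (fun m => ?_) Metric.isOpen_ball hub
        refine DifferentiableOn.const_mul ?_ _
        simp only [fwdDiff_iter_eq_sum_shift]
        refine DifferentiableOn.fun_sum fun j _ => ?_
        exact (differentiable_normTerm ℓ _).differentiableOn.const_smul _
    · intro s hs
      have hs' : 2 * (r : ℝ) < s.re := by push_cast at hs; linarith
      have hcomm : (fwdDiff (v 0))^[p] (twistedSeries ℓ ξ v s) a = ∑' m : Fin (r + 1) → ℕ,
          (∏ j, ξ j ^ m j) * (fwdDiff (v 0))^[p] (normTerm ℓ s) (a + ∑ j, m j • v j) := by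
        rw [fwdDiff_iter_eq_sum_shift]
        simp only [twistedSeries]
        have hsm : ∀ j : ℕ, Summable fun m : Fin (r + 1) → ℕ =>
            ((-1 : ℤ) ^ (p - j) * p.choose j) • ((∏ j, ξ j ^ m j) *
              normTerm ℓ s (a + j • v 0 + ∑ j, m j • v j)) := fun j =>
          (summable_twistedSeries ℓ ξ hξ v hv s hs _
            (pos_add_nsmul ℓ a (v 0) ha (hv 0) j)).const_smul _
        simp only [zsmul_eq_mul] at hsm ⊢
        simp only [← tsum_mul_left]
        rw [← Summable.tsum_finsetSum fun j _ => hsm j]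
        refine tsum_congr fun m => ?_
        rw [fwdDiff_iter_eq_sum_shift, Finset.mul_sum]
        refine Finset.sum_congr rfl fun j _ => ?_
        rw [zsmul_eq_mul, add_right_comm]
        ring
      rw [eq_sum_fwdDiff_of_recurrence (v 0) a (ξ 0) (hξ1 0) (twistedSeries ℓ ξ v s)
        (H s) (fun j => ?_) p]
      · rw [hcomm]
      · have hj := pos_add_nsmul ℓ a (v 0) ha (hv 0) j
        rw [(hH _ hj).2.1 s hs', ← twistedSeries_sub ℓ ξ hξ v hv s hs _ hj, succ_nsmul, add_assoc]
    · have hbox := hpoly.boxValue ξ v b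
      have hz : ∀ m : Fin (r + 1) → ℕ,
          (fwdDiff (v 0))^[p] (normTerm ℓ (-k)) (a + ∑ j, m j • v j) = 0 := by
        intro m
        rw [fwdDiff_iter_congr _ _ _ (fun x : M => ∏ i, (ℓ i x : ℂ) ^ k) p fun j =>
          normTerm_neg_natCast ℓ k _ (pos_add_nsmul ℓ _ (v 0)
            (pos_add_sum_nsmul ℓ a v ha hv m) (hv 0) j), hpoly.fwdDiff_iter_eq_zero _ hpb]
        rfl
      rw [eq_sum_fwdDiff_of_recurrence (v 0) a (ξ 0) (hξ1 0) (boxValue ξ v _ b)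
        (H (-k)) (fun j => ?_) p, hbox.fwdDiff_iter_eq_zero _ hpb]
      · simp [hz]
      · have hj := pos_add_nsmul ℓ a (v 0) ha (hv 0) j
        rw [(hH _ hj).2.2, ← boxValue_sub ξ (hξ1 0) v hpoly hb, succ_nsmul, add_assoc]

end Continuation

theorem norm_eq_prod_re {F : Type*} [Field F] [NumberField F] (htr : IsTotallyRealField F) (x : F) :
    ((Algebra.norm ℚ x : ℚ) : ℝ) = ∏ φ : F →ₐ[ℚ] ℂ, (φ x).re := by
  have h := Algebra.norm_eq_prod_embeddings ℚ ℂ x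
  have h1 : ∀ φ : F →ₐ[ℚ] ℂ, φ x = ((φ x).re : ℂ) := fun φ =>
    Complex.ext rfl (by simpa using htr φ.toRingHom x)
  rw [Finset.prod_congr rfl fun φ _ => h1 φ, eq_ratCast, ← Complex.ofReal_prod] at h
  exact_mod_cast h

/-- A real embedding underlying a complex embedding of a totally real field. -/
def realEmbedding {F : Type*} [Field F] (htr : IsTotallyRealField F) (φ : F →+* ℂ) : F →+* ℝ where
  toFun x := (φ x).re
  map_one' := by simp
  map_mul' x y := by simp [htr φ]
  map_zero' := by simp
  map_add' x y := by simp

/-- Values of an analytic function on a connected open set are determined by a large disc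
continuation. -/
theorem eq_of_disc_continuations {U : Set ℂ} (hUopen : IsOpen U) (hUconn : IsConnected U)
    {f : ℂ → ℂ} (hf : AnalyticOnNhd ℂ f U) {s₀ s₁ : ℂ} (h₀ : s₀ ∈ U) (h₁ : s₁ ∈ U) (c : ℂ) (K₀ : ℕ)
    (H : ∀ K : ℕ, K₀ ≤ K → ∃ g : ℂ → ℂ, DifferentiableOn ℂ g (Metric.ball 0 K) ∧
      f =ᶠ[nhds s₀] g ∧ g s₁ = c) :
    f s₁ = c := by
  obtain ⟨γ, hγ⟩ := (hUopen.isConnected_iff_isPathConnected.1 hUconn).joinedIn s₀ h₀ s₁ h₁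
  have hcpt : IsCompact (Set.range γ) := isCompact_range γ.continuous
  obtain ⟨R, hR⟩ := hcpt.isBounded.subset_ball 0
  obtain ⟨K, hK⟩ := exists_nat_ge (max R K₀)
  obtain ⟨g, hg, hfg, hgc⟩ := H K (by exact_mod_cast (le_max_right _ _).trans hK)
  have hsub : Set.range γ ⊆ Metric.ball 0 K :=
    hR.trans (Metric.ball_subset_ball ((le_max_left _ _).trans hK))
  have hsubU : Set.range γ ⊆ U := by rintro _ ⟨t, rfl⟩; exact hγ t
  rw [← hgc]
  exact (hf.mono hsubU).eqOn_of_preconnected_of_eventuallyEq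
    ((hg.analyticOnNhd Metric.isOpen_ball).mono hsub) (isPreconnected_range γ.continuous)
    ⟨0, γ.source⟩ hfg ⟨1, γ.target⟩

/-- **Cassou-Noguès, norm version.** For a totally real field `F` of degree `n`,
totally positive `z, v_1, …, v_r ∈ F`, and roots of unity `ξ_j ≠ 1`, any analytic
continuation `f` (to a connected open set containing `-k` and `Re s > r`) of
`∑_m (∏_j ξ_j^{m_j}) N(z + m·v)^{-s}` satisfies
`f(-k) = ∑_{m ∈ ℤ_{≥1}^r, ∑ m_i ≤ nk+r} (1-ξ)^{-m} ∑_{1 ≤ l_i ≤ m_i} {m;l} N(z - l·v)^k`,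
and the inner sum vanishes whenever `∑ m_i > nk + r`. -/
theorem cassouNogues_value_norm (F : Type*) [Field F] [NumberField F]
    (htr : IsTotallyRealField F) (n : ℕ) (hn : n = Module.finrank ℚ F)
    (r k : ℕ) (hr : 1 ≤ r)
    (z : F) (hz : ∀ σ : F →+* ℝ, 0 < σ z)
    (v : Fin r → F) (hv : ∀ i, ∀ σ : F →+* ℝ, 0 < σ (v i))
    (ξ : Fin r → ℂ) (hξroot : ∀ j, ∃ nn : ℕ, 0 < nn ∧ ξ j ^ nn = 1) (hξne : ∀ j, ξ j ≠ 1)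
    (U : Set ℂ) (hUopen : IsOpen U) (hUconn : IsConnected U)
    (hUk : (-(k : ℂ)) ∈ U) (hUhp : {s : ℂ | (r : ℝ) < s.re} ⊆ U)
    (f : ℂ → ℂ) (hf : AnalyticOnNhd ℂ f U)
    (hfs : ∀ s : ℂ, (r : ℝ) < s.re →
      f s = ∑' m : Fin r → ℕ,
        (∏ j, ξ j ^ m j) *
          Complex.exp (-s *
            (Real.log ((Algebra.norm ℚ (z + ∑ i, (m i : ℕ) • v i) : ℚ) : ℝ) : ℂ))) :
    f (-(k : ℂ)) =
      ∑ m ∈ (Fintype.piFinset fun _ : Fin r => Finset.Icc 1 (n * k + r)).filter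
          (fun m => ∑ i, m i ≤ n * k + r),
        (∏ i, (1 - ξ i) ^ m i)⁻¹ *
          ∑ l ∈ Fintype.piFinset fun i => Finset.Icc 1 (m i),
            (∏ i, (-1 : ℂ) ^ (l i - 1) * ((m i - 1).choose (l i - 1) : ℂ)) *
              ((Algebra.norm ℚ (z - ∑ i, (l i : ℕ) • v i) : ℚ) : ℂ) ^ k ∧
    ∀ m : Fin r → ℕ, (∀ i, 1 ≤ m i) → n * k + r < ∑ i, m i →
      (∑ l ∈ Fintype.piFinset fun i => Finset.Icc 1 (m i),
        (∏ i, (-1 : ℂ) ^ (l i - 1) * ((m i - 1).choose (l i - 1) : ℂ)) *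
          ((Algebra.norm ℚ (z - ∑ i, (l i : ℕ) • v i) : ℚ) : ℂ) ^ k) = 0 := by
  classical
  let ℓ : (F →ₐ[ℚ] ℂ) → F →+ ℝ := fun φ => (realEmbedding htr φ.toRingHom).toAddMonoidHom
  have hcard : Fintype.card (F →ₐ[ℚ] ℂ) = n := by rw [hn, AlgHom.card]
  have : Nonempty (F →ₐ[ℚ] ℂ) := by
    rw [← Fintype.card_pos_iff, hcard, hn]
    exact Module.finrank_pos
  have hnorm : ∀ x : F, ((Algebra.norm ℚ x : ℚ) : ℝ) = ∏ φ, ℓ φ x := norm_eq_prod_re htr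
  set g : F → ℂ := fun x => ((Algebra.norm ℚ x : ℚ) : ℂ) ^ k with hg
  have hgprod : g = fun x => ∏ φ, (ℓ φ x : ℂ) ^ k := by
    funext x
    rw [Finset.prod_pow, ← Complex.ofReal_prod, ← hnorm, Complex.ofReal_ratCast]
  have hpoly : IsPolyMap (n * k + 1) g := by
    rw [hgprod, ← hcard]
    exact IsPolyMap.prod_pow Finset.univ
      (fun φ => (Complex.ofRealHom : ℝ →+* ℂ).toAddMonoidHom.comp (ℓ φ)) k
  have hzℓ : ∀ φ, 0 < ℓ φ z := fun φ => hz (realEmbedding htr φ.toRingHom)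
  have hvℓ : ∀ j φ, 0 < ℓ φ (v j) := fun j φ =>
    hv j (realEmbedding htr φ.toRingHom)
  have hvanish : ∀ m : Fin r → ℕ, (∀ i, 1 ≤ m i) → n * k + r < ∑ i, m i →
      innerSum v g m z = 0 := fun m hm hlt => by
    rw [innerSum_eq_zero v m hpoly hm (by omega)]
    rfl
  refine ⟨?_, hvanish⟩
  have hξ : ∀ j, ‖ξ j‖ ≤ 1 := fun j => by
    obtain ⟨N, hN, hN1⟩ := hξroot j
    exact (Complex.norm_eq_one_of_pow_eq_one hN1 hN.ne').le
  have hvalue : f (-(k : ℂ)) = boxValue ξ v g (n * k + r) z := by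
    have hre : ((2 * r + 1 : ℕ) : ℂ).re = 2 * r + 1 := by simp
    have hopen : IsOpen {s : ℂ | 2 * (r : ℝ) < s.re} :=
      isOpen_lt continuous_const Complex.continuous_re
    refine eq_of_disc_continuations hUopen hUconn hf
      (s₀ := ((2 * r + 1 : ℕ) : ℂ)) (hUhp ?_) hUk _ (k + 1) fun K hK => ?_
    · change (r : ℝ) < ((2 * r + 1 : ℕ) : ℂ).re
      rw [hre]
      linarith [(Nat.cast_nonneg r : (0 : ℝ) ≤ r)]
    obtain ⟨H, hH⟩ :=
      exists_continuation ℓ K k (n * k + r) hK (by rw [hcard]; omega) ξ hξ hξne v hvℓ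
    obtain ⟨h1, h2, h3⟩ := hH z hzℓ
    refine ⟨fun s => H s z, h1, ?_, by rw [hgprod]; exact h3⟩
    filter_upwards [hopen.mem_nhds (show 2 * (r : ℝ) < ((2 * r + 1 : ℕ) : ℂ).re by
      rw [hre]; linarith)] with s hs
    rw [h2 s hs, hfs s (by linarith [(Nat.cast_nonneg r : (0 : ℝ) ≤ r)])]
    refine tsum_congr fun m => ?_
    rw [normTerm, hnorm, Real.log_prod fun φ _ => (pos_add_sum_nsmul ℓ z v hzℓ hvℓ m φ).ne']
  rw [hvalue, boxValue]
  symm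
  refine Finset.sum_subset (Finset.filter_subset _ _) fun m hm hm' => ?_
  have hpos : ∀ i, 1 ≤ m i := fun i => (Finset.mem_Icc.1 (Fintype.mem_piFinset.1 hm i)).1
  rw [Finset.mem_filter, not_and, not_le] at hm'
  exact mul_eq_zero_of_right _ (hvanish m hpos (hm' hm))
end
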